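/- arXiv:1003.5639 — 3 statements merged into one kernel-verified Lean document; each statement's English description precedes it below -/
import Mathlib

section
/- A henselian valued field (K,v) of characteristic p>0 is separable-algebraically maximal if and only if (K,v) is O-extremal with respect to every separable p-polynomial in one variable with coefficients in K. -/
open scoped Classical

noncomputable section

namespace ValuedDefect

universe u v

variable {K : Type u} {L : Type v} [Field K] [Field L]

/-- The ramification index `(vL : vK)`: the index of the image of `Kˣ` in the
value group `Lˣ / Bˣ` of the valuation subring `B` of `L`. -/
def ramIndex (K : Type u) {L : Type v} [Field K] [Field L] [Algebra K L]
    (B : ValuationSubring L) : ℕ :=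
  (Subgroup.map (QuotientGroup.mk' B.unitGroup)
    (MonoidHom.range (Units.map (algebraMap K L).toMonoidHom))).index

/-- The ring homomorphism `A →+* B` induced by `algebraMap K L` when `B` lies above `A`. -/
def valHom [Algebra K L] (A : ValuationSubring K) (B : ValuationSubring L)
    (h : B.comap (algebraMap K L) = A) : A →+* B where
  toFun x := ⟨algebraMap K L x, by
    have hx : (x : K) ∈ B.comap (algebraMap K L) := by rw [h]; exact x.2
    exact ValuationSubring.mem_comap.mp hx⟩
  map_one' := Subtype.ext (by simp)
  map_mul' x y := Subtype.ext (by simp)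
  map_zero' := Subtype.ext (by simp)
  map_add' x y := Subtype.ext (by simp)

theorem valHom_isLocalHom [Algebra K L] (A : ValuationSubring K) (B : ValuationSubring L)
    (h : B.comap (algebraMap K L) = A) : IsLocalHom (valHom A B h) := by
  constructor
  intro x hx
  rcases isUnit_iff_exists_inv.mp hx with ⟨y, hy⟩
  have hy' : algebraMap K L (x : K) * (y : L) = 1 := congrArg Subtype.val hy
  have hx0 : (x : K) ≠ 0 := by
    rintro h0
    rw [h0, map_zero, zero_mul] at hy'
    exact zero_ne_one hy'
  have hyx : (y : L) = algebraMap K L ((x : K)⁻¹) := by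
    rw [map_inv₀]
    exact eq_inv_of_mul_eq_one_right hy'
  have hmem : ((x : K)⁻¹ : K) ∈ A := by
    have hB : algebraMap K L ((x : K)⁻¹) ∈ B := hyx ▸ y.2
    have := ValuationSubring.mem_comap.mpr hB
    rwa [h] at this
  refine isUnit_iff_exists_inv.mpr ⟨⟨(x : K)⁻¹, hmem⟩, Subtype.ext ?_⟩
  exact mul_inv_cancel₀ hx0

/-- The residue degree `[Lv : Kv]` of an extension of valuation subrings. -/
def residueDegree [Algebra K L] (A : ValuationSubring K) (B : ValuationSubring L) : ℕ :=
  if h : B.comap (algebraMap K L) = A then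
    letI := valHom_isLocalHom A B h
    letI := (IsLocalRing.ResidueField.map (valHom A B h)).toAlgebra
    Module.finrank (IsLocalRing.ResidueField A) (IsLocalRing.ResidueField B)
  else 0

/-- A finite extension of valued fields (with unique extension of the valuation) is
defectless if `[L : K] = (vL : vK) · [Lv : Kv]`. -/
def IsDefectless [Algebra K L] (A : ValuationSubring K) (B : ValuationSubring L) : Prop :=
  Module.finrank K L = ramIndex K B * residueDegree A B

/-- An extension of valued fields is immediate if `vL = vK` and `Lv = Kv`. -/
def IsImmediate (K : Type u) {L : Type v} [Field K] [Field L] [Algebra K L]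
    (B : ValuationSubring L) : Prop :=
  (∀ x : L, x ≠ 0 → ∃ c : K, B.valuation x = B.valuation (algebraMap K L c)) ∧
  ∀ x : L, B.valuation x ≤ 1 → ∃ c : K, B.valuation (x - algebraMap K L c) < 1

/-- A valued field is a defectless field if every finite extension is defectless. -/
def IsDefectlessField {K : Type u} [Field K] (A : ValuationSubring K) : Prop :=
  ∀ (L : Type u) [Field L] [Algebra K L], FiniteDimensional K L →
    ∀ B : ValuationSubring L, B.comap (algebraMap K L) = A → IsDefectless A B

/-- A valued field is a separably defectless field if every finite separable extension is
defectless. -/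
def IsSepDefectlessField {K : Type u} [Field K] (A : ValuationSubring K) : Prop :=
  ∀ (L : Type u) [Field L] [Algebra K L], FiniteDimensional K L → Algebra.IsSeparable K L →
    ∀ B : ValuationSubring L, B.comap (algebraMap K L) = A → IsDefectless A B

/-- A valued field is inseparably defectless if every finite purely inseparable extension is
defectless. -/
def IsInsepDefectless {K : Type u} [Field K] (A : ValuationSubring K) : Prop :=
  ∀ (L : Type u) [Field L] [Algebra K L], FiniteDimensional K L → IsPurelyInseparable K L →
    ∀ B : ValuationSubring L, B.comap (algebraMap K L) = A → IsDefectless A B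

/-- A valued field is algebraically maximal if it admits no proper immediate algebraic
extension. -/
def IsAlgMaximal {K : Type u} [Field K] (A : ValuationSubring K) : Prop :=
  ∀ (L : Type u) [Field L] [Algebra K L], Algebra.IsAlgebraic K L →
    ∀ B : ValuationSubring L, B.comap (algebraMap K L) = A → IsImmediate K B →
      Function.Surjective (algebraMap K L)

/-- A valued field is separable-algebraically maximal if it admits no proper immediate
separable-algebraic extension. -/
def IsSepAlgMaximal {K : Type u} [Field K] (A : ValuationSubring K) : Prop :=
  ∀ (L : Type u) [Field L] [Algebra K L], Algebra.IsAlgebraic K L → Algebra.IsSeparable K L →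
    ∀ B : ValuationSubring L, B.comap (algebraMap K L) = A → IsImmediate K B →
      Function.Surjective (algebraMap K L)

/-- `(K,v)` is `K`-extremal with respect to `f` if the set `{v f(a) : a ∈ K}` has a maximum
(in the multiplicative convention: a minimum). -/
def KExtremal (A : ValuationSubring K) (f : Polynomial K) : Prop :=
  ∃ a : K, ∀ b : K, A.valuation (f.eval a) ≤ A.valuation (f.eval b)

/-- `(K,v)` is `O`-extremal with respect to `f` if the set `{v f(a) : a ∈ O}` has a maximum. -/
def OExtremal (A : ValuationSubring K) (f : Polynomial K) : Prop :=
  ∃ a : A, ∀ b : A, A.valuation (f.eval (a : K)) ≤ A.valuation (f.eval (b : K))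

/-- `K`-extremality for multivariable polynomials. -/
def KExtremalMv (A : ValuationSubring K) {n : ℕ} (f : MvPolynomial (Fin n) K) : Prop :=
  ∃ a : Fin n → K, ∀ b : Fin n → K,
    A.valuation (MvPolynomial.eval a f) ≤ A.valuation (MvPolynomial.eval b f)

/-- A `p`-polynomial: an additive polynomial plus a constant. -/
def IsPPolynomial (p : ℕ) (f : Polynomial K) : Prop :=
  ∃ (c : K) (m : ℕ) (co : ℕ → K),
    f = Polynomial.C c + ∑ i ∈ Finset.range (m + 1), Polynomial.C (co i) * Polynomial.X ^ p ^ i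

/-- A field of characteristic `p > 0` is Artin-Schreier closed if every polynomial
`X^p - X - a` has a root. -/
def ASClosed (K : Type*) [Field K] (p : ℕ) : Prop :=
  ∀ a : K, ∃ x : K, x ^ p - x = a

/-- The subfield `K^p` of `p`-th powers of a field of characteristic `p`. -/
def pPowerSubfield (K : Type*) [Field K] (p : ℕ) (hp : p.Prime) [CharP K p] : Subfield K :=
  haveI : Fact p.Prime := ⟨hp⟩
  (frobenius K p).fieldRange

/-- The field `K^{1/p}` of `p`-th roots of `K` inside a purely inseparable extension `P`. -/
def pthRootField (K : Type u) (P : Type v) [Field K] [Field P] [Algebra K P]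
    (p : ℕ) (hp : p.Prime) [CharP K p] : IntermediateField K P :=
  haveI : Fact p.Prime := ⟨hp⟩
  haveI : CharP P p := charP_of_injective_algebraMap (algebraMap K P).injective p
  { carrier := {x : P | x ^ p ∈ (algebraMap K P).range}
    mul_mem' := fun {a b} ha hb => by
      rcases ha with ⟨c, hc⟩
      rcases hb with ⟨d, hd⟩
      exact ⟨c * d, by rw [map_mul, hc, hd, mul_pow]⟩
    one_mem' := ⟨1, by rw [map_one, one_pow]⟩
    add_mem' := fun {a b} ha hb => by
      rcases ha with ⟨c, hc⟩
      rcases hb with ⟨d, hd⟩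
      exact ⟨c + d, by rw [map_add, hc, hd, add_pow_char]⟩
    zero_mem' := ⟨0, by rw [map_zero, zero_pow hp.ne_zero]⟩
    algebraMap_mem' := fun r => ⟨r ^ p, by rw [map_pow]⟩
    inv_mem' := fun x hx => by
      rcases hx with ⟨c, hc⟩
      exact ⟨c⁻¹, by rw [map_inv₀, hc, inv_pow]⟩ }

/-- A (possibly infinite) algebraic extension of valued fields is defectless if every finite
subextension is defectless. -/
def IsDefectlessAlgExt {K : Type u} {L : Type v} [Field K] [Field L] [Algebra K L]
    (A : ValuationSubring K) (B : ValuationSubring L) : Prop :=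
  ∀ E : IntermediateField K L, FiniteDimensional K E →
    IsDefectless A (B.comap (algebraMap E L))

open Polynomial in
/-- The coefficients of a product of linear polynomials `X - r` lie in any subring containing
the roots `r`. -/
theorem coeff_prod_X_sub_C_mem {R : Type*} [CommRing R] (S : Subring R) (s : Finset R)
    (hs : ∀ r ∈ s, r ∈ S) (n : ℕ) : (∏ r ∈ s, (X - C r)).coeff n ∈ S := by
  have h : (∏ r ∈ s, (X - C r)) ∈ lifts S.subtype := by
    refine Subsemiring.prod_mem _ fun r hr => ?_
    exact (lifts_iff_liftsRing S.subtype _).mpr <| sub_mem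
      ((lifts_iff_liftsRing S.subtype _).mp (X_mem_lifts _))
      ((lifts_iff_liftsRing S.subtype _).mp (C_mem_lifts _ (⟨r, hs r hr⟩ : S)))
  obtain ⟨x, hx⟩ := (lifts_iff_coeff_lifts _).mp h n
  exact hx ▸ x.2

/-- The finite set of conjugates of `x` over `K`. -/
def conjugates (K : Type u) {L : Type v} [Field K] [Field L] [Algebra K L] (x : L) : Finset L :=
  ((minpoly K x).aroots L).toFinset

theorem isSeparable_of_isConjRoot [Algebra K L] {x y : L} (hx : IsSeparable K x)
    (h : IsConjRoot K x y) : IsSeparable K y := by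
  have h' : minpoly K x = minpoly K y := h
  unfold IsSeparable at *
  rwa [← h']

theorem mem_conjugates [Algebra K L] {x y : L} (hx : IsIntegral K x) :
    y ∈ conjugates K x ↔ IsConjRoot K x y := by
  rw [conjugates, Multiset.mem_toFinset, isConjRoot_iff_mem_minpoly_aroots hx]

open Polynomial in
theorem map_minpoly_eq_prod [Algebra K L] [IsAlgClosed L] {x : L} (hx : IsSeparable K x) :
    (minpoly K x).map (algebraMap K L) = ∏ r ∈ conjugates K x, (X - C r) := by
  have hs : ((minpoly K x).map (algebraMap K L)).Splits := IsAlgClosed.splits _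
  have hm : ((minpoly K x).map (algebraMap K L)).Monic := (minpoly.monic hx.isIntegral).map _
  have hnd : ((minpoly K x).map (algebraMap K L)).roots.Nodup :=
    nodup_roots (Separable.map hx)
  conv_lhs => rw [hs.eq_prod_roots_of_monic hm]
  rw [conjugates, aroots, Finset.prod, Multiset.toFinset_val, hnd.dedup]

theorem mem_range_of_forall_algEquiv [Algebra K L] [IsAlgClosed L] [Algebra.IsAlgebraic K L]
    {x : L} (hx : IsSeparable K x) (h : ∀ σ : L ≃ₐ[K] L, σ x = x) :
    ∃ c : K, algebraMap K L c = x := by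
  have : IsAlgClosure K L := ⟨inferInstance, inferInstance⟩
  have : Normal K L := IsAlgClosure.normal K L
  by_contra hc
  have hn : x ∉ (⊥ : Subalgebra K L) := fun hb => hc (Algebra.mem_bot.mp hb)
  obtain ⟨y, hne, hy⟩ := (notMem_iff_exists_ne_and_isConjRoot hx (IsAlgClosed.splits _)).mp hn
  obtain ⟨σ, rfl⟩ := hy.symm.exists_algEquiv
  exact hne (h σ).symm

section Extension

variable [Algebra K L] {A : ValuationSubring K} {W : ValuationSubring L}

theorem valuation_algebraMap_le_iff (hW : W.comap (algebraMap K L) = A) (x y : K) :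
    W.valuation (algebraMap K L x) ≤ W.valuation (algebraMap K L y) ↔
      A.valuation x ≤ A.valuation y := by
  have key : ∀ z : K, W.valuation (algebraMap K L z) ≤ 1 ↔ A.valuation z ≤ 1 := fun z => by
    rw [ValuationSubring.valuation_le_one_iff, ValuationSubring.valuation_le_one_iff, ← hW,
      ValuationSubring.mem_comap]
  rcases eq_or_ne y 0 with rfl | hy
  · simp
  · have h1 : 0 < A.valuation y := by simpa [zero_lt_iff] using hy
    have h2 : 0 < W.valuation (algebraMap K L y) := by simpa [zero_lt_iff] using hy
    rw [← div_le_one₀ h1, ← div_le_one₀ h2, ← map_div₀, ← map_div₀, ← map_div₀, key]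

theorem valuation_algebraMap_lt_iff (hW : W.comap (algebraMap K L) = A) (x y : K) :
    W.valuation (algebraMap K L x) < W.valuation (algebraMap K L y) ↔
      A.valuation x < A.valuation y := by
  rw [← not_le, ← not_le, valuation_algebraMap_le_iff hW]

open Polynomial in
/-- Hensel's lemma for the minimal polynomial of a separable element which is congruent to `1`
and whose other conjugates are congruent to `0`. -/
theorem mem_range_of_isolated [HenselianLocalRing A] [IsAlgClosed L]
    (hW : W.comap (algebraMap K L) = A) {y : L} (hy : IsSeparable K y)
    (hy1 : W.valuation (y - 1) < 1)
    (hconj : ∀ z, IsConjRoot K y z → z ≠ y → W.valuation z < 1) :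
    ∃ c : K, algebraMap K L c = y := by
  have hyint : IsIntegral K y := hy.isIntegral
  have hyW : W.valuation y ≤ 1 := by
    have := W.valuation.map_add_le hy1.le (le_of_eq W.valuation.map_one)
    simpa using this
  have hcW : ∀ r ∈ conjugates K y, r ∈ W.toSubring := by
    intro r hr
    refine (W.valuation_le_one_iff r).mp ?_
    by_cases hry : r = y
    · rwa [hry]
    · exact (hconj r ((mem_conjugates hyint).mp hr) hry).le
  have hprod := map_minpoly_eq_prod hy
  have hlift : minpoly K y ∈ lifts (A.subtype) := by
    refine (lifts_iff_coeff_lifts _).mpr fun n => ?_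
    have h1 := coeff_prod_X_sub_C_mem W.toSubring (conjugates K y) hcW n
    rw [← hprod, coeff_map] at h1
    have h2 : (minpoly K y).coeff n ∈ A := by
      rw [← hW]
      exact ValuationSubring.mem_comap.mpr h1
    exact ⟨⟨_, h2⟩, rfl⟩
  obtain ⟨q, hq, -, hqm⟩ := lifts_and_natDegree_eq_and_monic hlift (minpoly.monic hyint)
  have hymem : y ∈ conjugates K y := (mem_conjugates hyint).mpr (IsConjRoot.refl)
  set g : L[X] := ∏ r ∈ (conjugates K y).erase y, (X - C r) with hg
  have hfac : (minpoly K y).map (algebraMap K L) = (X - C y) * g := by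
    rw [hprod, hg, Finset.mul_prod_erase _ (fun r => X - C r) hymem]
  have hqmap : q.map ((algebraMap K L).comp A.subtype) = (X - C y) * g := by
    rw [← hfac, ← hq, map_map]
  have heval : ∀ f : A[X], algebraMap K L ((f.eval 1 : A) : K)
      = (f.map ((algebraMap K L).comp A.subtype)).eval 1 := by
    intro f
    have : (1 : L) = ((algebraMap K L).comp A.subtype) 1 := by simp
    rw [this, eval_map_apply]
    rfl
  have hg1 : W.valuation (g.eval 1) = 1 := by
    rw [hg, eval_prod, map_prod]
    refine Finset.prod_eq_one fun r hr => ?_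
    rw [Finset.mem_erase] at hr
    have := hconj r ((mem_conjugates hyint).mp hr.2) hr.1
    simp only [eval_sub, eval_X, eval_C]
    rw [Valuation.map_sub_eq_of_lt_left _ (by simpa using this), map_one]
  have hg1' : W.valuation (g.derivative.eval 1) ≤ 1 := by
    rw [W.valuation_le_one_iff, eval_eq_sum_range]
    refine sum_mem fun n _ => ?_
    rw [one_pow, mul_one, coeff_derivative]
    refine mul_mem (coeff_prod_X_sub_C_mem W.toSubring _
      (fun r hr => hcW r (Finset.mem_of_mem_erase hr)) _) ?_
    exact add_mem (natCast_mem W n) (one_mem W)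
  have hy1' : W.valuation (1 - y) < 1 := by rwa [Valuation.map_sub_swap]
  obtain ⟨a, ha, -⟩ := HenselianLocalRing.is_henselian q hqm 1
    (by
      rw [ValuationSubring.valuation_lt_one_iff]
      have := (valuation_algebraMap_lt_iff hW ((q.eval 1 : A) : K) 1).mp
      simp only [map_one] at this
      refine this ?_
      rw [heval, hqmap, eval_mul, map_mul, hg1]
      simpa using hy1')
    (by
      rw [ValuationSubring.valuation_eq_one_iff]
      have h1 : W.valuation (algebraMap K L ((q.derivative.eval 1 : A) : K)) = 1 := by
        rw [heval, ← derivative_map, hqmap]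
        simp only [derivative_mul, derivative_sub, derivative_X, derivative_C, sub_zero, one_mul,
          eval_add, eval_mul, eval_sub, eval_X, eval_C]
        rw [Valuation.map_add_eq_of_lt_left, hg1]
        rw [hg1, map_mul]
        exact mul_lt_one_of_lt_of_le hy1' hg1'
      refine le_antisymm (ValuationSubring.valuation_le_one _ _) ?_
      have := (valuation_algebraMap_le_iff hW 1 ((q.derivative.eval 1 : A) : K)).mp
      simp only [map_one] at this
      exact this h1.ge)
  have hroot : (minpoly K y).IsRoot (a : K) := by
    rw [← hq]
    exact ha.map (f := A.subtype)
  have hdeg := degree_eq_one_of_irreducible_of_root (minpoly.irreducible hyint) hroot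
  exact minpoly.mem_range_of_degree_eq_one K y hdeg

open Polynomial in
/-- A separable element whose valuation is strictly larger than that of all its other conjugates
lies in the henselian ground field. -/
theorem mem_range_of_dominant [HenselianLocalRing A] [IsAlgClosed L] [Algebra.IsAlgebraic K L]
    (hW : W.comap (algebraMap K L) = A) {x : L} (hx : IsSeparable K x) (hx0 : x ≠ 0)
    (hconj : ∀ z, IsConjRoot K x z → z ≠ x → W.valuation z < W.valuation x) :
    ∃ c : K, algebraMap K L c = x := by
  have : IsAlgClosure K L := ⟨inferInstance, inferInstance⟩
  have : Normal K L := IsAlgClosure.normal K L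
  have hxint := hx.isIntegral
  have hmem : x ∈ conjugates K x := (mem_conjugates hxint).mpr IsConjRoot.refl
  set T : L := ∑ r ∈ conjugates K x, r with hT
  have hTK : ∃ t : K, algebraMap K L t = T := by
    refine ⟨-(minpoly K x).nextCoeff, ?_⟩
    rw [map_neg, ← nextCoeff_map (algebraMap K L).injective, map_minpoly_eq_prod hx,
      prod_X_sub_C_nextCoeff, neg_neg]
  obtain ⟨t, ht⟩ := hTK
  have hvx : 0 < W.valuation x := by simpa [zero_lt_iff] using hx0
  have hsub : W.valuation (T - x) < W.valuation x := by
    rw [hT, ← Finset.add_sum_erase _ _ hmem, add_sub_cancel_left]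
    refine Valuation.map_sum_lt' _ hvx fun r hr => ?_
    rw [Finset.mem_erase] at hr
    exact hconj r ((mem_conjugates hxint).mp hr.2) hr.1
  have hvT : W.valuation T = W.valuation x := by
    have h : T = T - x + x := by ring
    rw [h, Valuation.map_add_eq_of_lt_right _ hsub]
  have hT0 : T ≠ 0 := by
    intro h0
    rw [h0, map_zero] at hvT
    exact hvx.ne hvT
  have ht0 : t ≠ 0 := by
    rintro rfl
    exact hT0 (by rw [← ht, map_zero])
  have hsep : IsSeparable K (x / T) := by
    rw [← mem_separableClosure_iff, ← ht]
    exact div_mem (mem_separableClosure_iff.mpr hx) (algebraMap_mem _ t)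
  obtain ⟨c, hc⟩ := mem_range_of_isolated (A := A) hW hsep
    (by
      have h : x / T - 1 = -(T - x) / T := by field_simp; ring
      rw [h, map_div₀, Valuation.map_neg, hvT]
      exact (div_lt_one₀ hvx).mpr hsub)
    (by
      intro z hz hne
      obtain ⟨σ, rfl⟩ := hz.symm.exists_algEquiv
      have hσ : σ (x / T) = σ x / T := by rw [map_div₀, ← ht, σ.commutes]
      rw [hσ] at hne ⊢
      rw [map_div₀, hvT]
      refine (div_lt_one₀ hvx).mpr (hconj _ (isConjRoot_of_algEquiv x σ) ?_)
      intro h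
      exact hne (by rw [h]))
  refine ⟨c * t, ?_⟩
  rw [map_mul, hc, ht, div_mul_cancel₀ _ hT0]

/-- The valuation on an algebraic closure of a henselian field is invariant under
automorphisms (on separable elements). -/
theorem valuation_algEquiv [HenselianLocalRing A] [IsAlgClosed L] [Algebra.IsAlgebraic K L]
    (hW : W.comap (algebraMap K L) = A) {x : L} (hx : IsSeparable K x) (σ : L ≃ₐ[K] L) :
    W.valuation (σ x) = W.valuation x := by
  have : IsAlgClosure K L := ⟨inferInstance, inferInstance⟩
  have : Normal K L := IsAlgClosure.normal K L
  rcases eq_or_ne x 0 with rfl | hx0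
  · simp
  have hxint := hx.isIntegral
  have hmem : x ∈ conjugates K x := (mem_conjugates hxint).mpr IsConjRoot.refl
  have hstab : ∀ (τ : L ≃ₐ[K] L), ∀ z ∈ conjugates K x, τ z ∈ conjugates K x := by
    intro τ z hz
    rw [mem_conjugates hxint] at hz ⊢
    exact hz.trans (isConjRoot_of_algEquiv z τ)
  obtain ⟨m, hm, hmax⟩ := Finset.exists_max_image (conjugates K x) W.valuation ⟨x, hmem⟩
  have hne0 : ∀ z ∈ conjugates K x, z ≠ 0 := fun z hz =>
    ((mem_conjugates hxint).mp hz).ne_zero hx0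
  have hvm : 0 < W.valuation m := by simpa [zero_lt_iff] using hne0 m hm
  set S := (conjugates K x).filter fun z => W.valuation z = W.valuation m with hS
  set P : L := ∏ z ∈ S, z with hP
  have hvP : W.valuation P = W.valuation m ^ S.card := by
    rw [hP, map_prod, ← Finset.prod_const]
    exact Finset.prod_congr rfl fun z hz => (Finset.mem_filter.mp hz).2
  have hlt : ∀ τ : L ≃ₐ[K] L, (∃ z ∈ S, τ z ∉ S) → W.valuation (τ P) < W.valuation P := by
    rintro τ ⟨z, hz, hτz⟩
    have hz' := (Finset.mem_filter.mp hz).1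
    have h1 : W.valuation (τ z) < W.valuation m := lt_of_le_of_ne (hmax _ (hstab τ z hz'))
      fun h => hτz (Finset.mem_filter.mpr ⟨hstab τ z hz', h⟩)
    have hcard : S.card = (S.erase z).card + 1 := (Finset.card_erase_add_one hz).symm
    rw [hvP, hP, map_prod, map_prod, ← Finset.mul_prod_erase _ _ hz, hcard, pow_succ']
    refine mul_lt_mul_of_lt_of_le_of_nonneg_of_pos h1 ?_ zero_le (pow_pos hvm _)
    rw [← Finset.prod_const]
    refine Finset.prod_le_prod' fun r hr => ?_
    exact hmax _ (hstab τ r (Finset.mem_filter.mp (Finset.mem_of_mem_erase hr)).1)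
  have hPsep : IsSeparable K P := by
    rw [← mem_separableClosure_iff]
    refine prod_mem fun z hz => mem_separableClosure_iff.mpr ?_
    exact isSeparable_of_isConjRoot hx ((mem_conjugates hxint).mp (Finset.mem_filter.mp hz).1)
  have hP0 : P ≠ 0 := Finset.prod_ne_zero_iff.mpr fun z hz => hne0 z (Finset.mem_filter.mp hz).1
  have hfix : ∀ τ : L ≃ₐ[K] L, (∀ z ∈ S, τ z ∈ S) → τ P = P := by
    intro τ hτ
    rw [hP, map_prod, ← Finset.prod_image (g := τ) (f := fun z => z) τ.injective.injOn,
      Finset.eq_of_subset_of_card_le (Finset.image_subset_iff.mpr hτ)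
        (Finset.card_image_of_injective _ τ.injective).ge]
  obtain ⟨c, hc⟩ := mem_range_of_dominant (A := A) hW hPsep hP0 (by
    intro z hz hne
    obtain ⟨τ, rfl⟩ := hz.symm.exists_algEquiv
    refine hlt τ ?_
    by_contra! h
    exact hne (hfix τ h))
  have hall : ∀ τ : L ≃ₐ[K] L, ∀ z ∈ S, τ z ∈ S := by
    intro τ z hz
    by_contra hτz
    have := hlt τ ⟨z, hz, hτz⟩
    rw [← hc, τ.commutes] at this
    exact this.false
  have hmS : m ∈ S := Finset.mem_filter.mpr ⟨hm, rfl⟩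
  obtain ⟨τ, hτ⟩ := ((mem_conjugates hxint).mp hm).exists_algEquiv
  have hxS : x ∈ S := hτ ▸ hall τ m hmS
  rw [(Finset.mem_filter.mp hxS).2, (Finset.mem_filter.mp (hall σ x hxS)).2]

end Extension

theorem choose_prime_pow_mul_cast {F : Type*} [CommRing F] (p : ℕ) [Fact p.Prime] [CharP F p]
    (a m : ℕ) : (((p ^ a * m).choose (p ^ a) : ℕ) : F) = m := by
  have hp : 0 < p ^ a := pow_pos (Fact.out : p.Prime).pos a
  have h : (1 + Polynomial.X : Polynomial F) ^ (p ^ a * m)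
      = Polynomial.expand F (p ^ a) ((1 + Polynomial.X) ^ m) := by
    rw [pow_mul, add_pow_char_pow, one_pow, map_pow, map_add, map_one, Polynomial.expand_X]
  have h2 := congrArg (fun q => Polynomial.coeff q (1 * p ^ a)) h
  simp only [Polynomial.coeff_expand_mul hp] at h2
  simpa [Polynomial.coeff_one_add_X_pow] using h2

open Polynomial in
/-- The polynomial whose roots form a coset of a finite additive group has constant
differences. -/
theorem taylor_prod_X_sub_C_coset {F : Type*} [Field F] (s : Finset F) (h0 : (0 : F) ∈ s)
    (hadd : ∀ x ∈ s, ∀ y ∈ s, x + y ∈ s) (hneg : ∀ x ∈ s, -x ∈ s) (b y : F) :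
    taylor y (∏ v ∈ s, (X - C (b + v)))
      = (∏ v ∈ s, (X - C (b + v))) + C (∏ v ∈ s, (y - v)) := by
  set f : F[X] := ∏ v ∈ s, (X - C (b + v)) with hf
  have hfm : f.Monic := monic_prod_of_monic _ _ fun v _ => monic_X_sub_C _
  have hfd : f.natDegree = s.card := by
    rw [hf, natDegree_prod_of_monic _ _ fun v _ => monic_X_sub_C _]
    simp only [natDegree_X_sub_C, Finset.sum_const, smul_eq_mul, mul_one]
  have hpos : 0 < s.card := Finset.card_pos.mpr ⟨0, h0⟩
  have hf0 : f ≠ 0 := hfm.ne_zero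
  set d : F[X] := taylor y f - f - C (∏ v ∈ s, (y - v)) with hd
  have hdeg1 : (taylor y f - f).degree < s.card := by
    have hlc : (taylor y f).leadingCoeff = f.leadingCoeff := by
      rw [leadingCoeff, natDegree_taylor, coeff_taylor_natDegree]
    have := degree_sub_lt_left (degree_taylor f y) (by simpa using hf0) hlc
    rwa [degree_taylor, degree_eq_natDegree hf0, hfd] at this
  have hdeg : d.degree < s.card := by
    refine lt_of_le_of_lt (degree_sub_le _ _) (max_lt hdeg1 ?_)
    exact lt_of_le_of_lt degree_C_le (by exact_mod_cast hpos)
  have hinj : Function.Injective fun v : F => b + v := add_right_injective b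
  have hd0 : d = 0 := by
    refine eq_zero_of_degree_lt_of_eval_finset_eq_zero (s.image fun v => b + v) ?_ ?_
    · rwa [Finset.card_image_of_injective _ hinj]
    · intro r hr
      obtain ⟨w, hw, rfl⟩ := Finset.mem_image.mp hr
      have h1 : f.eval (b + w) = 0 := by
        rw [hf, eval_prod]
        exact Finset.prod_eq_zero hw (by simp)
      have h2 : f.eval (b + w + y) = ∏ v ∈ s, (y - v) := by
        rw [hf, eval_prod]
        refine Finset.prod_bij' (fun v _ => v - w) (fun v _ => v + w) ?_ ?_ ?_ ?_ ?_
        · intro v hv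
          rw [sub_eq_add_neg]
          exact hadd v hv _ (hneg w hw)
        · intro v hv
          exact hadd v hv w hw
        · intro v _
          simp
        · intro v _
          simp
        · intro v _
          simp only [eval_sub, eval_X, eval_C]
          ring
      rw [hd, eval_sub, eval_sub, taylor_eval, h1, eval_C, h2]
      ring
  rw [← sub_eq_zero, ← sub_sub]
  exact hd0

open Polynomial in
theorem coeff_eq_zero_of_taylor_eq_add_C {F : Type*} [Field F] [Infinite F] (p : ℕ)
    [Fact p.Prime] [CharP F p] (f : F[X]) (h : ∀ y, ∃ e, taylor y f = f + C e) (n : ℕ)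
    (hn0 : n ≠ 0) (hn : ∀ i, n ≠ p ^ i) : f.coeff n = 0 := by
  have hp : p.Prime := Fact.out
  obtain ⟨a, m, hpm, rfl⟩ := Nat.exists_eq_pow_mul_and_not_dvd hn0 p hp.ne_one
  have hk : p ^ a ≠ 0 := pow_ne_zero _ hp.ne_zero
  have hder : hasseDeriv (p ^ a) f = C (f.coeff (p ^ a)) := by
    refine Polynomial.funext fun y => ?_
    obtain ⟨e, he⟩ := h y
    rw [← taylor_coeff, he, coeff_add, coeff_C, if_neg hk, add_zero, eval_C]
  have hm1 : m ≠ 1 := fun h1 => hn a (by rw [h1, mul_one])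
  have hm0 : m ≠ 0 := fun h0 => hpm (h0 ▸ dvd_zero p)
  have hm : 1 < m := by lia
  have hlt : p ^ a < p ^ a * m := lt_mul_of_one_lt_right (Nat.pos_of_ne_zero hk) hm
  have hc := congrArg (fun q => coeff q (p ^ a * m - p ^ a)) hder
  simp only [hasseDeriv_coeff, coeff_C] at hc
  rw [if_neg (by lia), Nat.sub_add_cancel hlt.le, choose_prime_pow_mul_cast] at hc
  refine (mul_eq_zero.mp hc).resolve_left ?_
  exact fun h0 => hpm ((CharP.cast_eq_zero_iff F p m).mp h0)

open Polynomial in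
theorem isPPolynomial_of_coeff {p : ℕ} (hp : p.Prime) (f : K[X])
    (h : ∀ n, n ≠ 0 → (∀ i, n ≠ p ^ i) → f.coeff n = 0) : IsPPolynomial p f := by
  refine ⟨f.coeff 0, f.natDegree, fun i => f.coeff (p ^ i), ?_⟩
  ext n
  rw [coeff_add, finsetSum_coeff]
  simp only [coeff_C_mul, coeff_X_pow, coeff_C, mul_ite, mul_one, mul_zero]
  rcases eq_or_ne n 0 with rfl | hn
  · rw [if_pos rfl, Finset.sum_eq_zero, add_zero]
    intro i _
    rw [if_neg (pow_ne_zero i hp.ne_zero).symm]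
  · rw [if_neg hn, zero_add]
    by_cases hi : ∃ i, n = p ^ i
    · obtain ⟨i, rfl⟩ := hi
      by_cases hir : i ∈ Finset.range (f.natDegree + 1)
      · rw [Finset.sum_eq_single_of_mem i hir, if_pos rfl]
        intro j _ hj
        exact if_neg fun h' => hj (Nat.pow_right_injective hp.two_le h').symm
      · have hd : f.natDegree < p ^ i := by
          rw [Finset.mem_range] at hir
          have := (Nat.lt_pow_self (n := i) hp.one_lt)
          lia
        rw [coeff_eq_zero_of_natDegree_lt hd, Finset.sum_eq_zero]
        intro j hj
        refine if_neg fun h' => hir ?_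
        rwa [Nat.pow_right_injective hp.two_le h']
    · push Not at hi
      rw [h n hn hi, Finset.sum_eq_zero]
      intro j _
      rw [if_neg (hi j)]

section Extension

variable [Algebra K L] {A : ValuationSubring K} {W : ValuationSubring L}

/-- If `K` is henselian and the separable element `x` has no best approximation in `K`, then the
difference of `x` and any conjugate is smaller than the distance of `x` to any element of `K`. -/
theorem valuation_conj_sub_lt [HenselianLocalRing A] [IsAlgClosed L] [Algebra.IsAlgebraic K L]
    (hW : W.comap (algebraMap K L) = A) {x : L} (hx : IsSeparable K x)
    (hbest : ∀ a : K, ∃ b : K,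
      W.valuation (x - algebraMap K L b) < W.valuation (x - algebraMap K L a))
    (σ : L ≃ₐ[K] L) (a : K) : W.valuation (σ x - x) < W.valuation (x - algebraMap K L a) := by
  obtain ⟨b, hb⟩ := hbest a
  refine lt_of_le_of_lt ?_ hb
  have hsep : IsSeparable K (x - algebraMap K L b) := by
    rw [← mem_separableClosure_iff]
    exact sub_mem (mem_separableClosure_iff.mpr hx) (algebraMap_mem _ b)
  have h := valuation_algEquiv hW hsep σ
  have h2 : σ x - x = σ (x - algebraMap K L b) - (x - algebraMap K L b) := by
    rw [map_sub, σ.commutes]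
    ring
  rw [h2]
  exact W.valuation.map_sub_le h.le le_rfl

open Polynomial in
/-- A separable integral element without a best approximation in `K` yields a separable
`p`-polynomial for which `K` is not `O`-extremal. -/
theorem exists_isPPolynomial_not_oExtremal (p : ℕ) [Fact p.Prime] [CharP K p]
    [HenselianLocalRing A] [IsAlgClosed L] [Algebra.IsAlgebraic K L]
    (hW : W.comap (algebraMap K L) = A) {x : L} (hx : IsSeparable K x) (hx1 : W.valuation x ≤ 1)
    (hbest : ∀ a : K, ∃ b : K,
      W.valuation (x - algebraMap K L b) < W.valuation (x - algebraMap K L a)) :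
    ∃ f : K[X], IsPPolynomial p f ∧ f.Separable ∧ ¬ OExtremal A f := by
  have hp : p.Prime := Fact.out
  have : IsAlgClosure K L := ⟨inferInstance, inferInstance⟩
  have : Normal K L := IsAlgClosure.normal K L
  have : CharP L p := charP_of_injective_algebraMap (algebraMap K L).injective p
  have hxint := hx.isIntegral
  set V : AddSubgroup L := AddSubgroup.closure ((fun z => z - x) '' (conjugates K x : Set L)) with hV
  have hVfin : Finite V := by
    have : IsAddTorsion V := fun v => isOfFinAddOrder_iff_nsmul_eq_zero.mpr
      ⟨p, hp.pos, Subtype.ext (by simp)⟩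
    have : AddGroup.FG V := by
      rw [AddGroup.fg_iff_addSubgroup_fg]
      exact ⟨(conjugates K x).image fun z => z - x, by rw [hV, Finset.coe_image]⟩
    exact AddCommGroup.finite_of_fg_isAddTorsion V ‹_›
  have hVsmall : ∀ v ∈ V, ∀ a : K, W.valuation v < W.valuation (x - algebraMap K L a) := by
    intro v hv a
    have hpos : 0 < W.valuation (x - algebraMap K L a) := by
      obtain ⟨b, hb⟩ := hbest a
      exact lt_of_le_of_lt zero_le hb
    induction hv using AddSubgroup.closure_induction with
    | mem y hy =>
      obtain ⟨z, hz, rfl⟩ := hy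
      obtain ⟨σ, rfl⟩ := ((mem_conjugates hxint).mp hz).symm.exists_algEquiv
      exact valuation_conj_sub_lt hW hx hbest σ a
    | zero => simpa using hpos
    | add y z _ _ hy hz => exact W.valuation.map_add_lt hy hz
    | neg y _ hy => rwa [Valuation.map_neg]
  have hVsep : ∀ v ∈ V, v ∈ separableClosure K L := by
    intro v hv
    induction hv using AddSubgroup.closure_induction with
    | mem y hy =>
      obtain ⟨z, hz, rfl⟩ := hy
      exact sub_mem (mem_separableClosure_iff.mpr
        (isSeparable_of_isConjRoot hx ((mem_conjugates hxint).mp hz)))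
        (mem_separableClosure_iff.mpr hx)
    | zero => exact zero_mem _
    | add y z _ _ hy hz => exact add_mem hy hz
    | neg y _ hy => exact neg_mem hy
  have hconjV : ∀ σ : L ≃ₐ[K] L, σ x - x ∈ V := fun σ =>
    AddSubgroup.subset_closure ⟨σ x, (mem_conjugates hxint).mpr (isConjRoot_of_algEquiv x σ), rfl⟩
  have hVstab : ∀ σ : L ≃ₐ[K] L, ∀ v ∈ V, σ v ∈ V := by
    intro σ v hv
    induction hv using AddSubgroup.closure_induction with
    | mem y hy =>
      obtain ⟨z, hz, rfl⟩ := hy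
      obtain ⟨τ, rfl⟩ := ((mem_conjugates hxint).mp hz).symm.exists_algEquiv
      have h : σ (τ x - x) = ((τ.trans σ) x - x) - (σ x - x) := by
        rw [map_sub, AlgEquiv.trans_apply]
        ring
      rw [h]
      exact sub_mem (hconjV _) (hconjV _)
    | zero => rw [map_zero]; exact zero_mem _
    | add y z _ _ hy hz => rw [map_add]; exact add_mem hy hz
    | neg y _ hy => rw [map_neg]; exact neg_mem hy
  have hVfs : (V : Set L).Finite := Set.toFinite _
  set s : Finset L := hVfs.toFinset with hs
  have hmem : ∀ v, v ∈ s ↔ v ∈ V := fun v => by simp [hs]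
  have hinj : Function.Injective fun v : L => x + v := add_right_injective x
  set R : Finset L := s.image fun v => x + v with hR
  have hmemR : ∀ r, r ∈ R ↔ r - x ∈ V := by
    intro r
    rw [hR, Finset.mem_image]
    constructor
    · rintro ⟨v, hv, rfl⟩
      simpa using (hmem v).mp hv
    · intro h
      exact ⟨r - x, (hmem _).mpr h, by ring⟩
  set F : L[X] := ∏ r ∈ R, (X - C r) with hF
  have hFV : F = ∏ v ∈ s, (X - C (x + v)) := by
    rw [hF, hR, Finset.prod_image hinj.injOn]
  have hcoeff : ∀ n, n ≠ 0 → (∀ i, n ≠ p ^ i) → F.coeff n = 0 := by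
    intro n hn0 hn
    have : Infinite L := IsAlgClosed.instInfinite
    refine coeff_eq_zero_of_taylor_eq_add_C p F (fun y => ⟨∏ v ∈ s, (y - v), ?_⟩) n hn0 hn
    rw [hFV]
    refine taylor_prod_X_sub_C_coset s ((hmem 0).mpr (zero_mem V)) ?_ ?_ x y
    · intro a ha b hb
      exact (hmem _).mpr (add_mem ((hmem a).mp ha) ((hmem b).mp hb))
    · intro a ha
      exact (hmem _).mpr (neg_mem ((hmem a).mp ha))
  have hRstab : ∀ σ : L ≃ₐ[K] L, R.image σ = R := by
    intro σ
    refine Finset.eq_of_subset_of_card_le (Finset.image_subset_iff.mpr fun r hr => ?_)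
      (Finset.card_image_of_injective _ σ.injective).ge
    rw [hmemR] at hr ⊢
    have h : σ r - x = σ (r - x) + (σ x - x) := by rw [map_sub]; ring
    rw [h]
    exact add_mem (hVstab σ _ hr) (hconjV σ)
  have hFfix : ∀ σ : L ≃ₐ[K] L, F.map (σ : L →+* L) = F := by
    intro σ
    conv_rhs => rw [hF, ← hRstab σ, Finset.prod_image σ.injective.injOn]
    rw [hF, Polynomial.map_prod]
    simp
  have hlift : F ∈ lifts (algebraMap K L) := by
    refine (lifts_iff_coeff_lifts _).mpr fun n => ?_
    have hsepn : IsSeparable K (F.coeff n) := by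
      rw [← mem_separableClosure_iff]
      refine coeff_prod_X_sub_C_mem (separableClosure K L).toSubfield.toSubring R ?_ n
      intro r hr
      have h := hVsep _ ((hmemR r).mp hr)
      have h2 : r = r - x + x := by ring
      rw [h2]
      exact add_mem h (mem_separableClosure_iff.mpr hx)
    refine mem_range_of_forall_algEquiv hsepn fun σ => ?_
    conv_rhs => rw [← hFfix σ, coeff_map]
    rfl
  obtain ⟨f, hf⟩ := (mem_lifts _).mp hlift
  have hval : ∀ a : K, W.valuation (algebraMap K L (f.eval a))
      = W.valuation (x - algebraMap K L a) ^ s.card := by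
    intro a
    have h : algebraMap K L (f.eval a) = F.eval (algebraMap K L a) := by
      rw [← hf, eval_map_apply]
    rw [h, hFV, eval_prod, map_prod, ← Finset.prod_const]
    refine Finset.prod_congr rfl fun v hv => ?_
    simp only [eval_sub, eval_X, eval_C]
    rw [Valuation.map_sub_swap, add_sub_right_comm]
    exact Valuation.map_add_eq_of_lt_left _ (hVsmall v ((hmem v).mp hv) a)
  refine ⟨f, isPPolynomial_of_coeff hp f fun n hn0 hn => ?_, ?_, ?_⟩
  · have h := hcoeff n hn0 hn
    rw [← hf, coeff_map] at h
    simpa using h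
  · rw [← separable_map (algebraMap K L), hf, hF]
    exact separable_prod_X_sub_C_iff'.mpr fun _ _ _ _ h => h
  · rintro ⟨a, ha⟩
    obtain ⟨b, hb⟩ := hbest a
    have hbA : b ∈ A := by
      rw [← hW, ValuationSubring.mem_comap, ← ValuationSubring.valuation_le_one_iff]
      have haW : W.valuation (algebraMap K L a) ≤ 1 := by
        rw [ValuationSubring.valuation_le_one_iff, ← ValuationSubring.mem_comap, hW]
        exact a.2
      have h1 : W.valuation (x - algebraMap K L b) ≤ 1 :=
        hb.le.trans (W.valuation.map_sub_le hx1 haW)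
      have h2 : algebraMap K L b = x - (x - algebraMap K L b) := by ring
      rw [h2]
      exact W.valuation.map_sub_le hx1 h1
    have h := ha ⟨b, hbA⟩
    rw [← valuation_algebraMap_le_iff hW, hval, hval] at h
    refine h.not_gt (pow_lt_pow_left₀ hb zero_le ?_)
    exact (Finset.card_pos.mpr ⟨0, (hmem 0).mpr (zero_mem V)⟩).ne'

/-- An element of an immediate extension which is not in `K` has no best approximation. -/
theorem IsImmediate.exists_valuation_sub_lt {B : ValuationSubring L} (h : IsImmediate K B) {x : L}
    (hx : ∀ c : K, algebraMap K L c ≠ x) (a : K) :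
    ∃ b : K, B.valuation (x - algebraMap K L b) < B.valuation (x - algebraMap K L a) := by
  have h0 : x - algebraMap K L a ≠ 0 := fun h0 => hx a (sub_eq_zero.mp h0).symm
  have hpos : 0 < B.valuation (x - algebraMap K L a) := by simpa [zero_lt_iff] using h0
  obtain ⟨c, hc⟩ := h.1 _ h0
  have hc0 : algebraMap K L c ≠ 0 := by
    intro hc0
    rw [hc, hc0, map_zero] at hpos
    exact hpos.false
  obtain ⟨d, hd⟩ := h.2 ((x - algebraMap K L a) / algebraMap K L c) (by
    rw [map_div₀, ← hc, div_self hpos.ne'])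
  refine ⟨a + c * d, ?_⟩
  have h2 : x - algebraMap K L (a + c * d)
      = ((x - algebraMap K L a) / algebraMap K L c - algebraMap K L d) * algebraMap K L c := by
    rw [map_add, map_mul]
    field_simp
    ring
  rw [h2, map_mul, ← hc]
  exact mul_lt_of_lt_one_left hpos hd

open Polynomial in
/-- If `f` is not `O`-extremal, then some root of `f` has no best approximation in `K`. -/
theorem exists_root_of_not_oExtremal [IsAlgClosed L] (hW : W.comap (algebraMap K L) = A)
    {f : K[X]} (hf : ¬ OExtremal A f) :
    ∃ x : L, aeval x f = 0 ∧ ∀ a : K, ∃ b : K,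
      W.valuation (x - algebraMap K L b) < W.valuation (x - algebraMap K L a) := by
  by_contra! hno
  apply hf
  have hf0 : f ≠ 0 := by
    rintro rfl
    exact hf ⟨0, fun b => by simp⟩
  set R : Multiset L := (f.map (algebraMap K L)).roots with hR
  have hval : ∀ a : K, W.valuation (algebraMap K L (f.eval a))
      = W.valuation (algebraMap K L f.leadingCoeff)
        * (R.map fun r => W.valuation (r - algebraMap K L a)).prod := by
    intro a
    have h := (IsAlgClosed.splits (f.map (algebraMap K L))).eq_prod_roots
    have h2 := congrArg (eval (algebraMap K L a)) h
    rw [eval_map_apply, eval_mul, eval_C, leadingCoeff_map, eval_multiset_prod,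
      Multiset.map_map] at h2
    rw [h2, map_mul, map_multiset_prod, Multiset.map_map]
    congr 2
    refine Multiset.map_congr rfl fun r _ => ?_
    simp [Valuation.map_sub_swap _ r]
  have hAW : ∀ a : A, W.valuation (algebraMap K L a) ≤ 1 := by
    intro a
    rw [ValuationSubring.valuation_le_one_iff, ← ValuationSubring.mem_comap, hW]
    exact a.2
  have happ : ∀ r ∈ R, ∃ a : A, ∀ b : A,
      W.valuation (r - algebraMap K L a) ≤ W.valuation (r - algebraMap K L b) := by
    intro r hr
    have hr0 : aeval r f = 0 := by
      have := (mem_roots_map hf0).mp hr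
      rwa [aeval_def]
    by_cases hrW : W.valuation r ≤ 1
    · obtain ⟨a, ha⟩ := hno r hr0
      have hr1 : W.valuation (r - algebraMap K L a) ≤ 1 := by
        refine (ha 0).trans ?_
        simpa using hrW
      have haA : a ∈ A := by
        rw [← hW, ValuationSubring.mem_comap, ← ValuationSubring.valuation_le_one_iff]
        have h2 : algebraMap K L a = r - (r - algebraMap K L a) := by ring
        rw [h2]
        exact W.valuation.map_sub_le hrW hr1
      exact ⟨⟨a, haA⟩, fun b => ha b⟩
    · refine ⟨0, fun b => ?_⟩
      rw [Valuation.map_sub_eq_of_lt_left _ ((hAW 0).trans_lt (not_le.mp hrW)),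
        Valuation.map_sub_eq_of_lt_left _ ((hAW b).trans_lt (not_le.mp hrW))]
  choose! app happ using happ
  rcases R.toFinset.eq_empty_or_nonempty with hR0 | hRne
  · refine ⟨0, fun b => ?_⟩
    rw [← valuation_algebraMap_le_iff hW, hval, hval, Multiset.toFinset_eq_empty.mp hR0]
    simp
  obtain ⟨r₀, -, hmin⟩ := Finset.exists_min_image R.toFinset
    (fun r => A.valuation (f.eval (app r : K))) hRne
  refine ⟨app r₀, fun b => ?_⟩
  obtain ⟨r, hr, hrmin⟩ := Finset.exists_min_image R.toFinset
    (fun r => W.valuation (r - algebraMap K L b)) hRne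
  refine (hmin r hr).trans ?_
  rw [← valuation_algebraMap_le_iff hW, hval, hval]
  refine mul_le_mul_right (Multiset.prod_map_le_prod_map _ _ fun t ht => ?_) _
  have h1 : W.valuation (r - algebraMap K L b) ≤ W.valuation (t - algebraMap K L b) :=
    hrmin t (Multiset.mem_toFinset.mpr ht)
  have h2 := (happ r (Multiset.mem_toFinset.mp hr) b).trans h1
  have h3 : t - algebraMap K L (app r : K)
      = (r - algebraMap K L (app r : K)) - (r - algebraMap K L b) + (t - algebraMap K L b) := by
    ring
  rw [h3]
  exact W.valuation.map_add_le (W.valuation.map_sub_le h2 h1) le_rfl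

/-- The value group of `K` is coinitial in the value group of an algebraic extension. -/
theorem exists_valuation_algebraMap_le [Algebra.IsAlgebraic K L]
    (hW : W.comap (algebraMap K L) = A) {y : L} (hy : y ≠ 0) :
    ∃ c : K, c ≠ 0 ∧ W.valuation (algebraMap K L c) ≤ W.valuation y := by
  have halg : IsAlgebraic A y⁻¹ :=
    (IsFractionRing.isAlgebraic_iff A K L).mpr (Algebra.IsAlgebraic.isAlgebraic y⁻¹)
  obtain ⟨c, hc0, hc⟩ := halg.exists_integral_multiple
  have hc0' : (c : K) ≠ 0 := by simpa using hc0
  refine ⟨c, hc0', ?_⟩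
  have hmem : W.valuation (algebraMap K L c * y⁻¹) ≤ 1 := by
    rw [ValuationSubring.valuation_le_one_iff]
    obtain ⟨q, hqm, hq⟩ := hc
    have hAW : ∀ a : A, algebraMap K L a ∈ W := fun a => by
      rw [← ValuationSubring.mem_comap, hW]
      exact a.2
    let φ : A →+* W := ((algebraMap K L).comp A.subtype).codRestrict W.toSubring hAW
    have hxint : IsIntegral W (algebraMap K L c * y⁻¹) := by
      refine ⟨q.map φ, hqm.map φ, ?_⟩
      rw [Polynomial.eval₂_map]
      rw [← hq, Algebra.smul_def]
      rfl
    obtain ⟨z, hz⟩ := IsIntegrallyClosed.isIntegral_iff.mp hxint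
    exact hz ▸ z.2
  have hpos : 0 < W.valuation y := by simpa [zero_lt_iff] using hy
  rw [map_mul, map_inv₀, ← div_eq_mul_inv] at hmem
  exact (div_le_one₀ hpos).mp hmem

/-- Every valuation subring extends along a field extension. -/
theorem exists_comap_eq (A : ValuationSubring K) :
    ∃ W : ValuationSubring L, W.comap (algebraMap K L) = A := by
  obtain ⟨W, hle, hloc⟩ := (A.toLocalSubring.map (algebraMap K L)).exists_le_valuationSubring
  refine ⟨W, ?_⟩
  have hAW : ∀ a ∈ A, algebraMap K L a ∈ W := fun a ha => hle ⟨a, ha, rfl⟩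
  ext a
  rw [ValuationSubring.mem_comap]
  refine ⟨fun ha => ?_, hAW a⟩
  by_contra haA
  have ha0 : a ≠ 0 := by
    rintro rfl
    exact haA (zero_mem A)
  have hinv : a⁻¹ ∈ A := (A.mem_or_inv_mem a).resolve_left haA
  let z : (A.toLocalSubring.map (algebraMap K L)).toSubring := ⟨algebraMap K L a⁻¹, a⁻¹, hinv, rfl⟩
  have hz : IsUnit (Subring.inclusion hle z) := by
    refine IsUnit.of_mul_eq_one ⟨algebraMap K L a, ha⟩ (Subtype.ext ?_)
    change algebraMap K L a⁻¹ * algebraMap K L a = 1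
    rw [← map_mul, inv_mul_cancel₀ ha0, map_one]
  obtain ⟨⟨-, b, hb, rfl⟩, hzb⟩ := (isUnit_of_map_unit _ z hz).exists_right_inv
  have h1 : algebraMap K L a⁻¹ * algebraMap K L b = 1 := congrArg Subtype.val hzb
  rw [← map_mul] at h1
  have h2 : a⁻¹ * b = 1 := (algebraMap K L).injective (by rw [h1, map_one])
  have h3 : b = a := by
    field_simp at h2
    exact h2
  exact haA (h3 ▸ hb)

open Polynomial in
/-- Close to a separable element without best approximation, every element can be replaced by a
separable one whose degree is not larger. -/
theorem exists_isSeparable_natDegree_le [HenselianLocalRing A] [IsAlgClosed L]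
    [Algebra.IsAlgebraic K L] (hW : W.comap (algebraMap K L) = A) {x : L} (hx : IsSeparable K x)
    (hbest : ∀ a : K, ∃ b : K,
      W.valuation (x - algebraMap K L b) < W.valuation (x - algebraMap K L a))
    {y : L} (hy : ∀ a : K, W.valuation (y - x) < W.valuation (x - algebraMap K L a)) :
    ∃ z : L, IsSeparable K z ∧
      (∀ a : K, W.valuation (z - x) < W.valuation (x - algebraMap K L a)) ∧
      (minpoly K z).natDegree ≤ (minpoly K y).natDegree := by
  by_cases hsep : IsSeparable K y
  · exact ⟨y, hsep, hy, le_rfl⟩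
  have hyint : IsIntegral K y := Algebra.IsIntegral.isIntegral y
  set g := minpoly K y with hg
  have hder : derivative g = 0 := by
    by_contra h
    exact hsep ((separable_iff_derivative_ne_zero (minpoly.irreducible hyint)).mpr h)
  have hy0 : y ≠ 0 := by
    rintro rfl
    exact hsep (map_zero (algebraMap K L) ▸ isSeparable_algebraMap 0)
  have hn2 : 2 ≤ g.natDegree := by
    by_contra h
    have h1 : g.natDegree = 1 := by
      have : 0 < g.natDegree := minpoly.natDegree_pos hyint
      omega
    obtain ⟨c, hc⟩ := minpoly.natDegree_eq_one_iff.mp h1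
    exact hsep (hc ▸ isSeparable_algebraMap c)
  obtain ⟨σ, hσ⟩ : ∃ σ : L ≃ₐ[K] L, σ x ≠ x := by
    by_contra! h
    obtain ⟨c, rfl⟩ := mem_range_of_forall_algEquiv hx h
    obtain ⟨b, hb⟩ := hbest c
    simp at hb
  set z := σ x - x with hz
  have hz0 : z ≠ 0 := sub_ne_zero.mpr hσ
  have hzlt : ∀ a : K, W.valuation z < W.valuation (x - algebraMap K L a) :=
    valuation_conj_sub_lt hW hx hbest σ
  obtain ⟨ε, hε0, hε⟩ := exists_valuation_algebraMap_le hW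
    (div_ne_zero (pow_ne_zero g.natDegree hz0) hy0)
  have hlow : (C ε * X : K[X]).degree < g.degree := by
    rw [degree_C_mul_X hε0, degree_eq_natDegree (minpoly.ne_zero hyint)]
    exact_mod_cast hn2
  have hmonic : (g + C ε * X).Monic := (minpoly.monic hyint).add_of_left hlow
  have hdeg : (g + C ε * X).natDegree = g.natDegree :=
    natDegree_add_eq_left_of_degree_lt hlow
  have hgsep : (g + C ε * X).Separable := by
    rw [separable_def, derivative_add, hder, zero_add, derivative_C_mul, derivative_X, mul_one]
    exact isCoprime_one_right.of_isCoprime_of_dvd_right (isUnit_C.mpr hε0.isUnit).dvd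
  have hsplit : ((g + C ε * X).map (algebraMap K L)).Splits := IsAlgClosed.splits _
  have hprod := congrArg (eval y) (hsplit.eq_prod_roots_of_monic (hmonic.map _))
  have hcard : Multiset.card ((g + C ε * X).map (algebraMap K L)).roots = g.natDegree := by
    rw [← hsplit.natDegree_eq_card_roots, natDegree_map, hdeg]
  set R := ((g + C ε * X).map (algebraMap K L)).roots with hR
  have hroot : ∀ r ∈ R, aeval r (g + C ε * X) = 0 := by
    intro r hr
    rw [aeval_def]
    exact (mem_roots_map hmonic.ne_zero).mp hr
  rw [eval_map_algebraMap, map_add, hg, minpoly.aeval, zero_add, map_mul, aeval_C, aeval_X,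
    eval_multiset_prod, Multiset.map_map] at hprod
  obtain ⟨r, hrR, hr⟩ : ∃ r ∈ R, ∀ a : K,
      W.valuation (y - r) < W.valuation (x - algebraMap K L a) := by
    by_contra! hno
    choose! app happ using hno
    have hRne : R.toFinset.Nonempty := by
      rw [Multiset.toFinset_nonempty, ← Multiset.card_pos, hcard]
      omega
    obtain ⟨r₀, -, hmin⟩ := Finset.exists_min_image R.toFinset
      (fun r => W.valuation (x - algebraMap K L (app r))) hRne
    have hpow : W.valuation (x - algebraMap K L (app r₀)) ^ g.natDegree
        ≤ W.valuation (algebraMap K L ε * y) := by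
      rw [hprod, map_multiset_prod, Multiset.map_map, ← hcard, ← Multiset.prod_replicate,
        ← Multiset.map_const']
      refine Multiset.prod_map_le_prod_map _ _ fun r hr => ?_
      simpa using (hmin r (Multiset.mem_toFinset.mpr hr)).trans (happ r hr)
    have hpow2 : W.valuation (algebraMap K L ε * y) ≤ W.valuation z ^ g.natDegree := by
      have hpos : 0 < W.valuation y := by simpa [zero_lt_iff] using hy0
      rw [map_div₀, map_pow] at hε
      rw [map_mul]
      exact (le_div_iff₀ hpos).mp hε
    exact (pow_lt_pow_left₀ (hzlt (app r₀)) zero_le (by omega)).not_ge (hpow.trans hpow2)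
  have hdvd := minpoly.dvd K r (hroot r hrR)
  refine ⟨r, hgsep.of_dvd hdvd, fun a => ?_, ?_⟩
  · have h : r - x = -(y - r) + (y - x) := by ring
    rw [h]
    exact W.valuation.map_add_lt (by rw [Valuation.map_neg]; exact hr a) (hy a)
  · exact (natDegree_le_of_dvd hdvd hmonic.ne_zero).trans hdeg.le

/-- A product of factors, each of which is dominated by its perturbation, is dominated. -/
theorem valuation_multiset_prod_sub_lt {ι : Type*} (R : Multiset ι) (f g : ι → L)
    (h : ∀ i ∈ R, W.valuation (f i - g i) < W.valuation (g i)) :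
    W.valuation ((R.map f).prod - (R.map g).prod) < W.valuation (R.map g).prod := by
  induction R using Multiset.induction_on with
  | empty => simp
  | cons i R ih =>
    have hi := h i (Multiset.mem_cons_self i R)
    have hR := ih fun j hj => h j (Multiset.mem_cons_of_mem hj)
    rw [Multiset.map_cons, Multiset.map_cons, Multiset.prod_cons, Multiset.prod_cons]
    set P := (R.map f).prod
    set Q := (R.map g).prod
    have hi0 : 0 < W.valuation (g i) := zero_le.trans_lt hi
    have hQ0 : 0 < W.valuation Q := zero_le.trans_lt hR
    have hfi : W.valuation (f i) = W.valuation (g i) := by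
      have h2 : f i = (f i - g i) + g i := by ring
      rw [h2, Valuation.map_add_eq_of_lt_right _ hi]
    have h1 : f i * P - g i * Q = f i * (P - Q) + (f i - g i) * Q := by ring
    rw [h1, map_mul]
    refine W.valuation.map_add_lt ?_ ?_
    · rw [map_mul, hfi]
      exact mul_lt_mul_of_pos_left hR hi0
    · rw [map_mul]
      exact mul_lt_mul_of_pos_right hi hQ0

open Polynomial in
/-- If no root of `h` is close to `x`, then the value of `h` at elements close to `x` is
approximated by values of `h` on `K`. -/
theorem exists_valuation_aeval_sub_lt [IsAlgClosed L] {x y : L}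
    (hbest : ∀ a : K, ∃ b : K,
      W.valuation (x - algebraMap K L b) < W.valuation (x - algebraMap K L a))
    (hy : ∀ a : K, W.valuation (y - x) < W.valuation (x - algebraMap K L a))
    {h : K[X]} (h0 : h ≠ 0)
    (hroots : ∀ r : L, aeval r h = 0 →
      ∃ a : K, W.valuation (x - algebraMap K L a) ≤ W.valuation (r - x)) :
    ∃ a : K, W.valuation (aeval y h - algebraMap K L (h.eval a))
      < W.valuation (algebraMap K L (h.eval a)) := by
  set R : Multiset L := (h.map (algebraMap K L)).roots with hR
  have heval : ∀ t : L, aeval t h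
      = algebraMap K L h.leadingCoeff * (R.map fun r => t - r).prod := by
    intro t
    have h2 := congrArg (eval t) (IsAlgClosed.splits (h.map (algebraMap K L))).eq_prod_roots
    rw [eval_map_algebraMap, eval_mul, eval_C, leadingCoeff_map, eval_multiset_prod,
      Multiset.map_map] at h2
    rw [h2]
    simp [R]
  obtain ⟨a, ha⟩ : ∃ a : K, ∀ r ∈ R,
      W.valuation (x - algebraMap K L a) < W.valuation (r - x) := by
    have hroots' : ∀ r ∈ R, ∃ a : K,
        W.valuation (x - algebraMap K L a) ≤ W.valuation (r - x) := fun r hr =>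
      hroots r ((mem_roots_map h0).mp hr)
    choose! app happ using hroots'
    rcases R.toFinset.eq_empty_or_nonempty with hR0 | hRne
    · exact ⟨0, by simp [Multiset.toFinset_eq_empty.mp hR0]⟩
    obtain ⟨r₀, -, hmin⟩ := Finset.exists_min_image R.toFinset
      (fun r => W.valuation (x - algebraMap K L (app r))) hRne
    obtain ⟨b, hb⟩ := hbest (app r₀)
    exact ⟨b, fun r hr =>
      hb.trans_le ((hmin r (Multiset.mem_toFinset.mpr hr)).trans (happ r hr))⟩
  refine ⟨a, ?_⟩
  rw [← aeval_algebraMap_apply_eq_algebraMap_eval, heval, heval, ← mul_sub, map_mul, map_mul]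
  refine mul_lt_mul_of_pos_left ?_ ?_
  · refine valuation_multiset_prod_sub_lt R _ _ fun r hr => ?_
    have h1 : y - r - (algebraMap K L a - r) = (y - x) + (x - algebraMap K L a) := by ring
    have h2 : algebraMap K L a - r = -((r - x) + (x - algebraMap K L a)) := by ring
    rw [h1, h2, Valuation.map_neg, Valuation.map_add_eq_of_lt_left _ (ha r hr)]
    exact (W.valuation.map_add_lt ((hy a).trans (ha r hr)) (ha r hr))
  · simpa [zero_lt_iff] using h0

open Polynomial in
/-- A separable element without best approximation in a henselian field gives rise to a proper
simple immediate separable extension. -/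
theorem exists_isSeparable_isImmediate_adjoin [HenselianLocalRing A] [IsAlgClosed L]
    [Algebra.IsAlgebraic K L] (hW : W.comap (algebraMap K L) = A) {x : L} (hx : IsSeparable K x)
    (hbest : ∀ a : K, ∃ b : K,
      W.valuation (x - algebraMap K L b) < W.valuation (x - algebraMap K L a)) :
    ∃ y : L, IsSeparable K y ∧ (∀ c : K, algebraMap K L c ≠ y) ∧
      IsImmediate K (W.comap (algebraMap (IntermediateField.adjoin K {y}) L)) := by
  have hxU : ∀ a : K, W.valuation (x - x) < W.valuation (x - algebraMap K L a) := by
    intro a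
    obtain ⟨b, hb⟩ := hbest a
    rw [sub_self, map_zero]
    exact zero_le.trans_lt hb
  have hex : ∃ n : ℕ, ∃ y : L, (minpoly K y).natDegree = n ∧
      ∀ a : K, W.valuation (y - x) < W.valuation (x - algebraMap K L a) := ⟨_, x, rfl, hxU⟩
  obtain ⟨y₀, hy₀n, hy₀⟩ := Nat.find_spec hex
  obtain ⟨y, hysep, hy, hyn⟩ := exists_isSeparable_natDegree_le hW hx hbest hy₀
  have hmin : ∀ z : L, (minpoly K z).natDegree < (minpoly K y).natDegree →
      ∃ a : K, W.valuation (x - algebraMap K L a) ≤ W.valuation (z - x) := by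
    intro z hz
    by_contra! h
    exact Nat.find_min hex (by omega) ⟨z, rfl, h⟩
  have hyint : IsIntegral K y := hysep.isIntegral
  have key : ∀ t : IntermediateField.adjoin K {y}, t ≠ 0 → ∃ c : K,
      W.valuation (algebraMap _ L (t - algebraMap K _ c))
        < W.valuation (algebraMap _ L (algebraMap K (IntermediateField.adjoin K {y}) c)) := by
    intro t ht
    obtain ⟨h, hdeg, rfl⟩ := (IntermediateField.adjoin.powerBasis hyint).exists_eq_aeval t
    rw [IntermediateField.adjoin.powerBasis_dim] at hdeg
    rw [IntermediateField.adjoin.powerBasis_gen] at ht ⊢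
    have h0 : h ≠ 0 := by
      rintro rfl
      exact ht (by simp)
    obtain ⟨a, ha⟩ := exists_valuation_aeval_sub_lt hbest hy h0 fun r hr =>
      hmin r ((natDegree_le_of_dvd (minpoly.dvd K r hr) h0).trans_lt hdeg)
    refine ⟨h.eval a, ?_⟩
    rw [map_sub, ← aeval_algebraMap_apply, IntermediateField.AdjoinSimple.algebraMap_gen,
      ← IsScalarTower.algebraMap_apply]
    exact ha
  refine ⟨y, hysep, ?_, fun t ht => ?_, fun t ht => ?_⟩
  · rintro c rfl
    have h := hy c
    rw [Valuation.map_sub_swap] at h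
    exact h.false
  · obtain ⟨c, hc⟩ := key t ht
    rw [valuation_algebraMap_lt_iff rfl] at hc
    refine ⟨c, ?_⟩
    have h : t = (t - algebraMap K _ c) + algebraMap K _ c := by ring
    conv_lhs => rw [h, Valuation.map_add_eq_of_lt_right _ hc]
  · rcases eq_or_ne t 0 with rfl | ht0
    · exact ⟨0, by simp⟩
    obtain ⟨c, hc⟩ := key t ht0
    rw [valuation_algebraMap_lt_iff rfl] at hc
    refine ⟨c, hc.trans_le ?_⟩
    have h : t = (t - algebraMap K _ c) + algebraMap K _ c := by ring
    rw [h, Valuation.map_add_eq_of_lt_right _ hc] at ht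
    exact ht

end Extension

/-- A henselian valued field of characteristic `p > 0` is separable-algebraically maximal if and
only if it is `O`-extremal with respect to every separable `p`-polynomial in one variable. -/
theorem statement5 {K : Type u} [Field K] (p : ℕ) (hp : 0 < p) [CharP K p]
    (A : ValuationSubring K) [HenselianLocalRing A] :
    IsSepAlgMaximal A ↔
      ∀ f : Polynomial K, IsPPolynomial p f → f.Separable → OExtremal A f := by
  have hp' : p.Prime := (CharP.char_is_prime_or_zero K p).resolve_right hp.ne'
  have : Fact p.Prime := ⟨hp'⟩
  constructor
  · intro hmax f _ hsep
    by_contra hf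
    obtain ⟨W, hW⟩ := exists_comap_eq (L := AlgebraicClosure K) A
    obtain ⟨x, hx, hbest⟩ := exists_root_of_not_oExtremal hW hf
    obtain ⟨y, hysep, hyK, himm⟩ := exists_isSeparable_isImmediate_adjoin hW
      (hsep.of_dvd (minpoly.dvd K x hx)) hbest
    have hE : Algebra.IsSeparable K (IntermediateField.adjoin K {y}) :=
      (IntermediateField.isSeparable_adjoin_simple_iff_isSeparable K _).mpr hysep
    obtain ⟨c, hc⟩ := hmax (IntermediateField.adjoin K {y}) inferInstance hE _ hW himm
      (IntermediateField.AdjoinSimple.gen K y)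
    refine hyK c ?_
    rw [IsScalarTower.algebraMap_apply K (IntermediateField.adjoin K {y}), hc,
      IntermediateField.AdjoinSimple.algebraMap_gen]
  · intro hext L _ _ halg hsep B hB himm x
    by_contra! hx
    have hx0 : x ≠ 0 := by
      rintro rfl
      exact hx 0 (map_zero _)
    obtain ⟨c, hc⟩ := himm.1 x hx0
    have hcx : B.valuation (algebraMap K L c) ≠ 0 := by
      rw [← hc]
      simpa using hx0
    have hc0 : algebraMap K L c ≠ 0 := by simpa using hcx
    have hxc : ∀ a : K, algebraMap K L a ≠ x / algebraMap K L c := by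
      intro a ha
      refine hx (a * c) ?_
      rw [map_mul, ha, div_mul_cancel₀ _ hc0]
    obtain ⟨W, hWB⟩ := exists_comap_eq (L := AlgebraicClosure L) B
    have : Algebra.IsAlgebraic K (AlgebraicClosure L) := Algebra.IsAlgebraic.trans K L _
    have hWA : W.comap (algebraMap K (AlgebraicClosure L)) = A := by
      rw [IsScalarTower.algebraMap_eq K L, ← ValuationSubring.comap_comap, hWB, hB]
    obtain ⟨f, hfp, hfsep, hf⟩ := exists_isPPolynomial_not_oExtremal p hWA
      (x := algebraMap L (AlgebraicClosure L) (x / algebraMap K L c))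
      (by
        unfold IsSeparable
        rw [minpoly.algebraMap_eq (algebraMap L (AlgebraicClosure L)).injective]
        exact Algebra.IsSeparable.isSeparable K _)
      (by
        rw [← map_one W.valuation, ← map_one (algebraMap L (AlgebraicClosure L)),
          valuation_algebraMap_le_iff hWB, map_div₀, hc, div_self hcx, map_one])
      (fun a => by
        obtain ⟨b, hb⟩ := himm.exists_valuation_sub_lt hxc a
        refine ⟨b, ?_⟩
        rwa [IsScalarTower.algebraMap_apply K L _ a, IsScalarTower.algebraMap_apply K L _ b, ← map_sub,
          ← map_sub, valuation_algebraMap_lt_iff hWB])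
    exact hf (hext f hfp hfsep)

end ValuedDefect
end
end

section
/- A valued field (K,v) is algebraically maximal if and only if (K,v) is henselian and K-extremal with respect to every polynomial in one variable with coefficients in K. -/
open scoped Classical

noncomputable section

namespace ValuedDefect

universe u v

variable {K : Type u} {L : Type v} [Field K] [Field L]

section Valuation

variable {Γ : Type*} [LinearOrderedCommGroupWithZero Γ] (w : Valuation L Γ)

theorem exists_valuation_sub_lt (x : L) (f : L → K) (φ : K → L)
    (hφ : ∀ a, ∃ b, w (x - φ b) < w (x - φ a)) (s : Multiset L)
    (hs : ∀ z ∈ s, w (x - φ (f z)) ≤ w (x - z)) :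
    ∃ b, ∀ z ∈ s, w (x - φ b) < w (x - z) := by
  induction s using Multiset.induction_on with
  | empty => exact ⟨0, by simp⟩
  | cons z s ih =>
    obtain ⟨b, hb⟩ := ih fun y hy => hs y (Multiset.mem_cons_of_mem hy)
    obtain ⟨c, hc⟩ := hφ (f z)
    have hcz := hc.trans_le (hs z (Multiset.mem_cons_self z s))
    rcases le_total (w (x - φ b)) (w (x - φ c)) with h | h
    · exact ⟨b, fun y hy => (Multiset.mem_cons.mp hy).elim
        (fun e => e ▸ h.trans_lt hcz) (hb y)⟩
    · exact ⟨c, fun y hy => (Multiset.mem_cons.mp hy).elim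
        (fun e => e ▸ hcz) fun hy => h.trans_lt (hb y hy)⟩

theorem valuation_mul_sub_mul_lt {p q p' q' : L} (h : w (p - q) < w p)
    (h' : w (p' - q') < w p') : w (p * p' - q * q') < w (p * p') := by
  have hp : 0 < w p := zero_le.trans_lt h
  have hp' : 0 < w p' := zero_le.trans_lt h'
  have hq : w q' = w p' := by
    simpa [sub_sub_cancel_left] using w.map_sub_eq_of_lt_right h'
  have e : p * p' - q * q' = p * (p' - q') + (p - q) * q' := by ring
  rw [e]
  refine w.map_add_lt ?_ ?_
  · rw [map_mul, map_mul]
    exact mul_lt_mul_of_pos_left h' hp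
  · rw [map_mul, map_mul, hq]
    exact mul_lt_mul_of_pos_right h hp'

theorem valuation_prod_sub_prod_lt {x b : L} (s : Multiset L)
    (hs : ∀ z ∈ s, w (x - b) < w (x - z)) :
    w ((s.map (x - ·)).prod - (s.map (b - ·)).prod) < w (s.map (x - ·)).prod := by
  induction s using Multiset.induction_on with
  | empty => simp
  | cons z s ih =>
    simp only [Multiset.map_cons, Multiset.prod_cons]
    refine valuation_mul_sub_mul_lt w ?_ (ih fun y hy => hs y (Multiset.mem_cons_of_mem hy))
    rw [sub_sub_sub_cancel_right]
    exact hs z (Multiset.mem_cons_self z s)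

theorem valuation_prod_sub_le_prod_sub {a b : L} (s : Multiset L)
    (hs : ∀ z ∈ s, w (a - z) ≤ w (b - z)) :
    w (s.map (a - ·)).prod ≤ w (s.map (b - ·)).prod := by
  induction s using Multiset.induction_on with
  | empty => simp
  | cons z s ih =>
    simp only [Multiset.map_cons, Multiset.prod_cons, map_mul]
    exact mul_le_mul' (hs z (Multiset.mem_cons_self z s))
      (ih fun y hy => hs y (Multiset.mem_cons_of_mem hy))

/-- If every element of `s` has a best approximation `φ (f z)`, then one of these points minimizes
the valuation of `∏ (X - z)` among all points in the range of `φ`. -/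
theorem exists_minimal_valuation_prod_sub (φ : K →+* L) (f : L → K) (s : Multiset L)
    (hf : ∀ z ∈ s, ∀ a, w (z - φ (f z)) ≤ w (z - φ a)) :
    ∃ a, ∀ b, w (s.map (φ a - ·)).prod ≤ w (s.map (φ b - ·)).prod := by
  rcases s.empty_or_exists_mem with rfl | ⟨z₀, hz₀⟩
  · exact ⟨0, by simp⟩
  have hne : (s.map f).toFinset.Nonempty :=
    ⟨f z₀, Multiset.mem_toFinset.mpr (Multiset.mem_map_of_mem f hz₀)⟩
  obtain ⟨a, -, ha⟩ := (s.map f).toFinset.exists_min_image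
    (fun a => w (s.map (φ a - ·)).prod) hne
  refine ⟨a, fun b => ?_⟩
  obtain ⟨i, hi, hib⟩ := (s.map f).toFinset.exists_min_image (fun i => w (φ b - φ i)) hne
  refine (ha i hi).trans (valuation_prod_sub_le_prod_sub w s fun z hz => ?_)
  have h₁ : w (φ b - φ i) ≤ w (φ b - φ (f z)) :=
    hib _ (Multiset.mem_toFinset.mpr (Multiset.mem_map_of_mem f hz))
  have h₂ : w (z - φ (f z)) ≤ w (φ b - z) := by
    rw [w.map_sub_swap (φ b)]; exact hf z hz b
  have h₃ : w (φ b - φ (f z)) ≤ w (φ b - z) := by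
    rw [← sub_add_sub_cancel (φ b) z]
    exact w.map_add_le le_rfl h₂
  have e : φ i - z = (φ b - z) - (φ b - φ i) := by ring
  rw [e]
  exact w.map_sub_le le_rfl (h₁.trans h₃)

theorem exists_mem_valuation_sub_lt_one {x : L} {s : Multiset L} (h : w (s.map (x - ·)).prod < 1) :
    ∃ z ∈ s, w (x - z) < 1 := by
  induction s using Multiset.induction_on with
  | empty => simp at h
  | cons z s ih =>
    by_cases hz : w (x - z) < 1
    · exact ⟨z, Multiset.mem_cons_self z s, hz⟩
    · have hs : w (s.map (x - ·)).prod < 1 := by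
        by_contra hs
        rw [Multiset.map_cons, Multiset.prod_cons, map_mul] at h
        exact absurd h (not_lt.mpr (one_le_mul (not_lt.mp hz) (not_lt.mp hs)))
      obtain ⟨y, hy, hyx⟩ := ih hs
      exact ⟨y, Multiset.mem_cons_of_mem hy, hyx⟩

end Valuation

section Comap

theorem exists_valuationSubring_comap_eq (i : K →+* L) (A : ValuationSubring K) :
    ∃ W : ValuationSubring L, W.comap i = A := by
  obtain ⟨W, hW, hloc⟩ := IsLocalRing.exists_factor_valuationRing (i.comp A.subtype)
  refine ⟨W, ValuationSubring.ext _ _ fun x => ⟨fun hx => ?_, fun hx => hW ⟨x, hx⟩⟩⟩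
  by_contra hxA
  have hx0 : x ≠ 0 := fun h => hxA (h ▸ A.zero_mem)
  have hinv : x⁻¹ ∈ A := (A.mem_or_inv_mem x).resolve_left hxA
  have hu : IsUnit (⟨x⁻¹, hinv⟩ : A) := by
    refine hloc.map_nonunit _ (IsUnit.of_mul_eq_one ⟨i x, hx⟩ (Subtype.ext ?_))
    change i x⁻¹ * i x = 1
    rw [← map_mul, inv_mul_cancel₀ hx0, map_one]
  obtain ⟨y, hy⟩ := isUnit_iff_exists_inv.mp hu
  have hy' : x⁻¹ * (y : K) = 1 := congrArg Subtype.val hy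
  have : (y : K) = x := by rw [← mul_right_inj' (inv_ne_zero hx0), hy', inv_mul_cancel₀ hx0]
  exact hxA (this ▸ y.2)

theorem valuation_comap_le_iff (i : K →+* L) (W : ValuationSubring L) {x y : K} :
    (W.comap i).valuation x ≤ (W.comap i).valuation y ↔
      W.valuation (i x) ≤ W.valuation (i y) := by
  rw [ValuationSubring.valuation_le_iff, ValuationSubring.valuation_le_iff]
  constructor
  · rintro ⟨a, rfl⟩
    exact ⟨⟨i a, a.2⟩, (map_mul i _ _).symm⟩
  · rintro ⟨a, ha⟩
    by_cases hy : y = 0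
    · refine ⟨0, ?_⟩
      rw [hy, map_zero, mul_zero] at ha
      simpa using ((map_eq_zero i).mp ha.symm).symm
    · have hiy : i y ≠ 0 := (map_ne_zero i).mpr hy
      refine ⟨⟨x / y, ?_⟩, div_mul_cancel₀ x hy⟩
      rw [ValuationSubring.mem_comap, map_div₀, ← ha, mul_div_cancel_right₀ _ hiy]
      exact a.2

theorem valuation_comap_lt_iff (i : K →+* L) (W : ValuationSubring L) {x y : K} :
    (W.comap i).valuation x < (W.comap i).valuation y ↔
      W.valuation (i x) < W.valuation (i y) := by
  rw [← not_le, ← not_le, valuation_comap_le_iff]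

theorem valuation_comap_lt_one_iff (i : K →+* L) (W : ValuationSubring L) {x : K} :
    (W.comap i).valuation x < 1 ↔ W.valuation (i x) < 1 := by
  simpa using valuation_comap_lt_iff i W (x := x) (y := 1)

end Comap

section Maximal

open Polynomial IntermediateField

variable [Algebra K L] {W : ValuationSubring L}

theorem exists_natDegree_lt_aeval_eq {y : L} (hy : IsIntegral K y) (u : K⟮y⟯) :
    ∃ g : K[X], g.natDegree < (minpoly K y).natDegree ∧ aeval y g = (u : L) := by
  have hu : (u : L) ∈ (K⟮y⟯).toSubalgebra := u.2
  rw [adjoin_simple_toSubalgebra_of_isAlgebraic hy.isAlgebraic,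
    Algebra.adjoin_singleton_eq_range_aeval] at hu
  obtain ⟨g, hg⟩ := hu
  refine ⟨g %ₘ minpoly K y, natDegree_modByMonic_lt g (minpoly.monic hy) (minpoly.ne_one K y), ?_⟩
  rw [minpoly.aeval_modByMonic_minpoly]
  exact hg

/-- If `y` has minimal degree among the elements with the same distances to all points of `K`, and
these distances have no minimum, then every polynomial of smaller degree can be approximated at
`y` by its values on `K`. -/
theorem exists_valuation_aeval_sub_lt_s6 [IsAlgClosed L] {y : L}
    (hy : ∀ c : K, ∃ a : K, W.valuation (y - algebraMap K L a) < W.valuation (y - algebraMap K L c))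
    (hmin : ∀ z : L, (∀ a : K, W.valuation (z - algebraMap K L a) =
      W.valuation (y - algebraMap K L a)) → (minpoly K y).natDegree ≤ (minpoly K z).natDegree)
    {g : K[X]} (hg0 : g ≠ 0) (hg : g.natDegree < (minpoly K y).natDegree) :
    ∃ b : K, W.valuation (aeval y g - algebraMap K L (g.eval b)) < W.valuation (aeval y g) := by
  have hroot : ∀ z ∈ g.aroots L, ∃ a : K,
      W.valuation (y - algebraMap K L a) ≤ W.valuation (y - z) := by
    intro z hz
    have hdeg : (minpoly K z).natDegree ≤ g.natDegree :=
      natDegree_le_of_dvd (minpoly.dvd K z (mem_aroots.mp hz).2) hg0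
    have hz' : ¬ ∀ a : K, W.valuation (z - algebraMap K L a) =
        W.valuation (y - algebraMap K L a) := fun h => by
      have := hmin z h
      omega
    obtain ⟨a, ha⟩ := not_forall.mp hz'
    refine ⟨a, ?_⟩
    have e : y - z = (y - algebraMap K L a) - (z - algebraMap K L a) := by ring
    rcases lt_or_gt_of_ne ha with h | h
    · rw [e, W.valuation.map_sub_eq_of_lt_left h]
    · rw [e, W.valuation.map_sub_eq_of_lt_right h]
      exact h.le
  choose! f hf using hroot
  obtain ⟨b, hb⟩ := exists_valuation_sub_lt W.valuation y f (algebraMap K L) hy _ hf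
  refine ⟨b, ?_⟩
  have hs := IsAlgClosed.splits (g.map (algebraMap K L))
  have hlc : 0 < W.valuation (g.map (algebraMap K L)).leadingCoeff := by
    rw [zero_lt_iff, Valuation.ne_zero_iff, leadingCoeff_ne_zero]
    exact (Polynomial.map_ne_zero_iff (algebraMap K L).injective).mpr hg0
  have h₁ : algebraMap K L (g.eval b) = (g.map (algebraMap K L)).eval (algebraMap K L b) := by
    rw [eval_map_apply]
  rw [h₁, ← eval_map_algebraMap, hs.eval_eq_prod_roots, hs.eval_eq_prod_roots, ← mul_sub, map_mul,
    map_mul]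
  exact mul_lt_mul_of_pos_left (valuation_prod_sub_prod_lt W.valuation _ hb) hlc

/-- Over an algebraically maximal field every algebraic element has a best approximation. -/
theorem IsAlgMaximal.exists_valuation_sub_le {K L : Type u} [Field K] [Field L] [Algebra K L]
    [IsAlgClosed L] [Algebra.IsAlgebraic K L] {A : ValuationSubring K} (hA : IsAlgMaximal A)
    {W : ValuationSubring L} (hW : W.comap (algebraMap K L) = A) (x : L) :
    ∃ c : K, ∀ a : K, W.valuation (x - algebraMap K L c) ≤ W.valuation (x - algebraMap K L a) := by
  by_contra! hx
  obtain ⟨y, hyx, hy⟩ := (measure fun y : L => (minpoly K y).natDegree).wf.has_min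
    {y | ∀ a : K, W.valuation (y - algebraMap K L a) = W.valuation (x - algebraMap K L a)}
    ⟨x, fun _ => rfl⟩
  have happrox : ∀ u : K⟮y⟯, u ≠ 0 → ∃ k : K,
      (W.comap (algebraMap K⟮y⟯ L)).valuation (u - algebraMap K K⟮y⟯ k) <
        (W.comap (algebraMap K⟮y⟯ L)).valuation u := by
    intro u hu
    obtain ⟨g, hg, hgu⟩ := exists_natDegree_lt_aeval_eq (Algebra.IsIntegral.isIntegral y) u
    have hg0 : g ≠ 0 := by
      rintro rfl
      exact hu (Subtype.ext (by simpa using hgu.symm))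
    obtain ⟨b, hb⟩ := exists_valuation_aeval_sub_lt_s6 (W := W) (y := y)
      (fun c => by simpa only [hyx _] using hx c)
      (fun z hz => not_lt.mp (hy z fun a => (hz a).trans (hyx a))) hg0 hg
    refine ⟨g.eval b, ?_⟩
    rw [valuation_comap_lt_iff, map_sub, ← IsScalarTower.algebraMap_apply]
    rw [hgu] at hb
    exact hb
  have himm : IsImmediate K (W.comap (algebraMap K⟮y⟯ L)) := by
    constructor
    · intro u hu
      obtain ⟨k, hk⟩ := happrox u hu
      refine ⟨k, ?_⟩
      simpa [sub_sub_cancel_left] using (Valuation.map_sub_eq_of_lt_right _ hk).symm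
    · intro u hu
      by_cases h0 : u = 0
      · exact ⟨0, by simp [h0]⟩
      · obtain ⟨k, hk⟩ := happrox u h0
        exact ⟨k, hk.trans_le hu⟩
  obtain ⟨c, hc⟩ := hA K⟮y⟯ inferInstance (W.comap (algebraMap K⟮y⟯ L))
    (by rw [ValuationSubring.comap_comap, ← IsScalarTower.algebraMap_eq, hW]) himm
    (AdjoinSimple.gen K y)
  have hcy : algebraMap K L c = y := congrArg (algebraMap K⟮y⟯ L) hc
  obtain ⟨a, ha⟩ := hx c
  rw [← hyx c, hcy, sub_self, map_zero] at ha
  exact not_lt_zero ha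

theorem IsAlgMaximal.kExtremal {K : Type u} [Field K] {A : ValuationSubring K}
    (hA : IsAlgMaximal A) (f : K[X]) : KExtremal A f := by
  obtain ⟨W, hW⟩ := exists_valuationSubring_comap_eq (algebraMap K (AlgebraicClosure K)) A
  choose c hc using hA.exists_valuation_sub_le hW
  obtain ⟨a, ha⟩ := exists_minimal_valuation_prod_sub W.valuation
    (algebraMap K (AlgebraicClosure K)) c (f.aroots _) fun z _ => hc z
  refine ⟨a, fun b => ?_⟩
  have hs := IsAlgClosed.splits (f.map (algebraMap K (AlgebraicClosure K)))
  rw [← hW, valuation_comap_le_iff, ← eval_map_apply, ← eval_map_apply, hs.eval_eq_prod_roots,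
    hs.eval_eq_prod_roots, map_mul, map_mul]
  exact mul_le_mul_right (ha b) _

theorem mem_maximalIdeal_iff_valuation_lt_one {A : ValuationSubring K}
    (hW : W.comap (algebraMap K L) = A) {a : A} :
    a ∈ IsLocalRing.maximalIdeal A ↔ W.valuation (algebraMap K L a) < 1 := by
  subst hW
  rw [ValuationSubring.valuation_lt_one_iff, valuation_comap_lt_one_iff]

theorem isUnit_iff_valuation_eq_one {A : ValuationSubring K} (hW : W.comap (algebraMap K L) = A)
    {a : A} : IsUnit a ↔ W.valuation (algebraMap K L a) = 1 := by
  have h₁ : W.valuation (algebraMap K L a) ≤ 1 := W.valuation_le_one (valHom A W hW a)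
  rw [← not_iff_not, ← mem_nonunits_iff, ← IsLocalRing.mem_maximalIdeal,
    mem_maximalIdeal_iff_valuation_lt_one hW]
  exact ⟨ne_of_lt, lt_of_le_of_ne h₁⟩

theorem mem_of_valuation_algebraMap_sub_lt_one {A : ValuationSubring K}
    (hW : W.comap (algebraMap K L) = A) {a : K} {z : L} (hz : z ∈ W)
    (h : W.valuation (z - algebraMap K L a) < 1) : a ∈ A := by
  rw [← hW, ValuationSubring.mem_comap, ← W.valuation_le_one_iff]
  rw [← sub_sub_cancel z (algebraMap K L a)]
  exact W.valuation.map_sub_le ((W.valuation_le_one_iff _).mpr hz) h.le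

/-- A Newton step improves any approximation `c` to a root `z` which lies in the residue disc
of `z`, if `c` is a simple root modulo the maximal ideal. -/
theorem exists_valuation_sub_lt_of_isUnit_derivative {A : ValuationSubring K}
    (hW : W.comap (algebraMap K L) = A) (f : A[X]) {z : W} (hz : f.eval₂ (valHom A W hW) z = 0)
    {c : A} (hc : IsUnit (f.derivative.eval c))
    (hzc : W.valuation (z - algebraMap K L c) < 1) (hne : (z : L) ≠ algebraMap K L c) :
    ∃ a : A, W.valuation (z - algebraMap K L a) < W.valuation (z - algebraMap K L c) := by
  obtain ⟨u, hu⟩ := hc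
  obtain ⟨k, hk⟩ := (f.map (valHom A W hW)).binomExpansion (valHom A W hW c) (z - valHom A W hW c)
  rw [add_sub_cancel, eval_map, hz, eval_map_apply, derivative_map, eval_map_apply, ← hu] at hk
  have hinv : valHom A W hW ↑u⁻¹ * valHom A W hW u = 1 := by
    rw [← map_mul, u.inv_mul, map_one]
  have key : z - valHom A W hW (c - ↑u⁻¹ * f.eval c) =
      -(valHom A W hW ↑u⁻¹ * k) * (z - valHom A W hW c) ^ 2 := by
    rw [map_sub, map_mul]
    linear_combination (-(z - valHom A W hW c)) * hinv - (valHom A W hW ↑u⁻¹) * hk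
  refine ⟨c - ↑u⁻¹ * f.eval c, ?_⟩
  have key' : (z : L) - algebraMap K L (c - ↑u⁻¹ * f.eval c : A) =
      (-(valHom A W hW ↑u⁻¹ * k) : W) * ((z : L) - algebraMap K L c) ^ 2 :=
    congrArg Subtype.val key
  have hpos : 0 < W.valuation (z - algebraMap K L c) :=
    zero_lt_iff.mpr ((Valuation.ne_zero_iff _).mpr (sub_ne_zero.mpr hne))
  rw [key', map_mul, map_pow]
  refine (mul_le_of_le_one_left' (W.valuation_le_one _)).trans_lt ?_
  rw [pow_two]
  exact mul_lt_of_lt_one_left hpos hzc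

theorem IsAlgMaximal.henselianLocalRing {K : Type u} [Field K] {A : ValuationSubring K}
    (hA : IsAlgMaximal A) : HenselianLocalRing A where
  is_henselian f hf a₀ h₀ h₁ := by
    obtain ⟨W, hW⟩ := exists_valuationSubring_comap_eq (algebraMap K (AlgebraicClosure K)) A
    have hs := IsAlgClosed.splits
      (f.map ((algebraMap K (AlgebraicClosure K)).comp A.subtype))
    have hev : W.valuation ((f.map ((algebraMap K (AlgebraicClosure K)).comp A.subtype)).eval
        (algebraMap K (AlgebraicClosure K) a₀)) < 1 := by
      have : algebraMap K (AlgebraicClosure K) a₀ =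
        ((algebraMap K (AlgebraicClosure K)).comp A.subtype) a₀ := rfl
      rw [this, eval_map_apply]
      exact (mem_maximalIdeal_iff_valuation_lt_one hW).mp h₀
    rw [hs.eval_eq_prod_roots_of_monic (hf.map _)] at hev
    obtain ⟨z, hz, hza⟩ := exists_mem_valuation_sub_lt_one W.valuation hev
    have hzW : z ∈ W := by
      rw [← W.valuation_le_one_iff, ← sub_sub_cancel (algebraMap K (AlgebraicClosure K) a₀) z]
      exact W.valuation.map_sub_le (W.valuation_le_one (valHom A W hW a₀)) hza.le
    rw [W.valuation.map_sub_swap] at hza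
    obtain ⟨c, hc⟩ := hA.exists_valuation_sub_le hW z
    have hzc := (hc a₀).trans_lt hza
    lift c to A using mem_of_valuation_algebraMap_sub_lt_one hW hzW hzc
    have hca : c - a₀ ∈ IsLocalRing.maximalIdeal A := by
      rw [mem_maximalIdeal_iff_valuation_lt_one hW]
      have e : algebraMap K (AlgebraicClosure K) (c - a₀ : A) =
        (z - algebraMap K _ (a₀ : K)) - (z - algebraMap K _ (c : K)) := by
          rw [sub_sub_sub_cancel_left]; exact map_sub _ _ _
      rw [e]
      exact W.valuation.map_sub_lt hza hzc
    have hfz : f.eval₂ (valHom A W hW) ⟨z, hzW⟩ = 0 := by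
      apply Subtype.val_injective
      have := (mem_roots'.mp hz).2
      rw [IsRoot, eval_map] at this
      exact (hom_eval₂ f (valHom A W hW) W.subtype ⟨z, hzW⟩).trans this
    have hunit : IsUnit (f.derivative.eval c) := by
      by_contra hn
      have h₂ := Ideal.mem_of_dvd _ (f.derivative.sub_dvd_eval_sub c a₀) hca
      have h₃ := sub_mem ((IsLocalRing.mem_maximalIdeal _).mpr hn) h₂
      rw [sub_sub_cancel] at h₃
      exact (IsLocalRing.mem_maximalIdeal _).mp h₃ h₁
    have hcz : z = algebraMap K (AlgebraicClosure K) c := by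
      by_contra hne
      obtain ⟨a, ha⟩ := exists_valuation_sub_lt_of_isUnit_derivative hW f hfz hunit hzc hne
      exact absurd ha (not_lt.mpr (hc a))
    refine ⟨c, ?_, hca⟩
    have hinj : Function.Injective ((algebraMap K (AlgebraicClosure K)).comp A.subtype) :=
      (algebraMap K (AlgebraicClosure K)).injective.comp A.subtype_injective
    apply hinj
    have := (mem_roots'.mp hz).2
    rw [IsRoot, hcz] at this
    rw [map_zero, ← this]
    exact (eval_map_apply (f := (algebraMap K (AlgebraicClosure K)).comp A.subtype) c).symm

end Maximal

section Henselian

open Polynomial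

variable [Algebra K L] {A : ValuationSubring K} {W : ValuationSubring L}

theorem normal_of_isAlgClosed [IsAlgClosed L] [Algebra.IsAlgebraic K L] : Normal K L :=
  have : IsAlgClosure K L := ⟨inferInstance, inferInstance⟩
  IsAlgClosure.normal K L

theorem minpoly_mem_lifts_of_isConjRoot_mem [IsAlgClosed L] [Algebra.IsAlgebraic K L]
    (hW : W.comap (algebraMap K L) = A) {x : L} (hx : ∀ y, IsConjRoot K x y → y ∈ W) :
    minpoly K x ∈ lifts A.subtype := by
  have hint : IsIntegral K x := Algebra.IsIntegral.isIntegral x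
  have hs := IsAlgClosed.splits ((minpoly K x).map (algebraMap K L))
  have hlift : (minpoly K x).map (algebraMap K L) ∈ lifts W.subtype := by
    rw [hs.eq_prod_roots_of_monic ((minpoly.monic hint).map _)]
    refine multiset_prod_mem _ fun p hp => ?_
    obtain ⟨y, hy, rfl⟩ := Multiset.mem_map.mp hp
    have hyW := hx y ((isConjRoot_iff_mem_minpoly_aroots hint).mpr hy)
    rw [sub_eq_add_neg, ← C_neg]
    exact add_mem (X_mem_lifts _) (C_mem_lifts W.subtype ⟨-y, neg_mem hyW⟩)
  rw [lifts_iff_coeff_lifts] at hlift ⊢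
  intro n
  obtain ⟨a, ha⟩ := hlift n
  rw [coeff_map] at ha
  refine ⟨⟨(minpoly K x).coeff n, ?_⟩, rfl⟩
  rw [← hW, ValuationSubring.mem_comap, ← ha]
  exact a.2

theorem valuation_eval_derivative_minpoly [IsAlgClosed L] [Algebra.IsAlgebraic K L] {x : L}
    (hsep : IsSeparable K x) (hx : W.valuation x = 1)
    (hconj : ∀ y, IsConjRoot K x y → y ≠ x → W.valuation y < 1) :
    W.valuation (aeval x (derivative (minpoly K x))) = 1 := by
  have hint : IsIntegral K x := hsep.isIntegral
  have hs := IsAlgClosed.splits ((minpoly K x).map (algebraMap K L))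
  have hmem : x ∈ (minpoly K x).aroots L :=
    (isConjRoot_iff_mem_minpoly_aroots hint).mp (IsConjRoot.refl)
  have hnodup : ((minpoly K x).aroots L).Nodup := nodup_roots (Separable.map hsep)
  rw [← eval_map_algebraMap, ← derivative_map,
    hs.eval_root_derivative ((minpoly.monic hint).map _) hmem, map_multiset_prod,
    Multiset.map_map]
  refine Multiset.prod_eq_one fun r hr => ?_
  obtain ⟨y, hy, rfl⟩ := Multiset.mem_map.mp hr
  have hy' := (hnodup.mem_erase_iff).mp hy
  have hlt := hconj y ((isConjRoot_iff_mem_minpoly_aroots hint).mpr hy'.2) hy'.1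
  rw [← hx] at hlt ⊢
  exact W.valuation.map_sub_eq_of_lt_left hlt

theorem mem_range_of_valuation_sub_one_lt [IsAlgClosed L] [Algebra.IsAlgebraic K L]
    [HenselianLocalRing A] (hW : W.comap (algebraMap K L) = A) {x : L}
    (hsep : IsSeparable K x) (hx : W.valuation (x - 1) < 1)
    (hconj : ∀ y, IsConjRoot K x y → y ≠ x → W.valuation y < 1) :
    x ∈ (algebraMap K L).range := by
  have hint : IsIntegral K x := hsep.isIntegral
  have hx1 : W.valuation x = 1 := by
    have := W.valuation.map_one_add_of_lt hx
    rwa [add_sub_cancel] at this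
  obtain ⟨h, hh, -, hmonic⟩ := lifts_and_degree_eq_and_monic
    (minpoly_mem_lifts_of_isConjRoot_mem hW (x := x) fun y hy => by
      rw [← W.valuation_le_one_iff]
      by_cases hyx : y = x
      · rw [hyx, hx1]
      · exact (hconj y hy hyx).le) (minpoly.monic hint)
  have hxW : x ∈ W := (W.valuation_le_one_iff x).mp hx1.le
  have haeval : ∀ p : A[X], ((p.eval₂ (valHom A W hW) ⟨x, hxW⟩ : W) : L) =
      aeval x (p.map A.subtype) := fun p => by
    rw [aeval_def, eval₂_map]
    exact hom_eval₂ p (valHom A W hW) W.subtype ⟨x, hxW⟩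
  have hclose : ∀ p : A[X],
      W.valuation (aeval x (p.map A.subtype) - algebraMap K L (p.eval 1 : A)) < 1 := by
    intro p
    obtain ⟨k, hk⟩ := (p.map (valHom A W hW)).sub_dvd_eval_sub ⟨x, hxW⟩ 1
    have e : ((p.map (valHom A W hW)).eval 1 : W) = valHom A W hW (p.eval 1) := by
      rw [← eval_map_apply, map_one]
    rw [e, eval_map] at hk
    have hk' := congrArg (Subtype.val : W → L) hk
    have e' : aeval x (p.map A.subtype) - algebraMap K L (p.eval 1 : A) = (x - 1) * k := by
      rw [← haeval]; exact hk'
    rw [e', map_mul]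
    exact (mul_le_of_le_one_right' (W.valuation_le_one k)).trans_lt hx
  have h₀ : h.eval 1 ∈ IsLocalRing.maximalIdeal A := by
    rw [mem_maximalIdeal_iff_valuation_lt_one hW]
    have := hclose h
    rwa [hh, minpoly.aeval, zero_sub, Valuation.map_neg] at this
  have h₁ : IsUnit (h.derivative.eval 1) := by
    rw [isUnit_iff_valuation_eq_one hW]
    have hd := hclose h.derivative
    have hd1 := valuation_eval_derivative_minpoly hsep hx1 hconj
    rw [← derivative_map, hh] at hd
    rw [← hd1, W.valuation.map_sub_swap] at hd
    rw [← hd1]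
    exact W.valuation.map_eq_of_sub_lt hd
  obtain ⟨c, hc, -⟩ := HenselianLocalRing.is_henselian h hmonic 1 h₀ h₁
  refine minpoly.mem_range_of_degree_eq_one K x
    (degree_eq_one_of_irreducible_of_root (minpoly.irreducible hint) (x := (c : K)) ?_)
  rw [← hh]
  exact hc.map (f := A.subtype)

/-- Over a henselian field, a separable element of strictly larger value than all its other
conjugates is rational. -/
theorem mem_range_of_forall_isConjRoot_valuation_lt [IsAlgClosed L] [Algebra.IsAlgebraic K L]
    [HenselianLocalRing A] (hW : W.comap (algebraMap K L) = A) {x : L} (hsep : IsSeparable K x)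
    (hconj : ∀ y, IsConjRoot K x y → y ≠ x → W.valuation y < W.valuation x) :
    x ∈ (algebraMap K L).range := by
  have : Normal K L := normal_of_isAlgClosed
  by_cases hx0 : x = 0
  · exact ⟨0, by rw [hx0, map_zero]⟩
  have hint : IsIntegral K x := hsep.isIntegral
  have hs := IsAlgClosed.splits ((minpoly K x).map (algebraMap K L))
  have hmem : x ∈ (minpoly K x).aroots L :=
    (isConjRoot_iff_mem_minpoly_aroots hint).mp IsConjRoot.refl
  have hnodup : ((minpoly K x).aroots L).Nodup := nodup_roots (Separable.map hsep)
  have hpos : 0 < W.valuation x := zero_lt_iff.mpr ((Valuation.ne_zero_iff _).mpr hx0)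
  obtain ⟨a, ha⟩ : ∃ a : K, W.valuation (x - algebraMap K L a) < W.valuation x := by
    refine ⟨-(minpoly K x).nextCoeff, ?_⟩
    have hsum := hs.nextCoeff_eq_neg_sum_roots_of_monic ((minpoly.monic hint).map _)
    rw [nextCoeff_map (algebraMap K L).injective] at hsum
    have hx_add : ((minpoly K x).aroots L).sum = x + (((minpoly K x).aroots L).erase x).sum := by
      rw [← Multiset.sum_cons, Multiset.cons_erase hmem]
    rw [map_neg, hsum, neg_neg, ← aroots_def, hx_add, sub_add_cancel_left, Valuation.map_neg]
    refine Multiset.sum_induction (W.valuation · < W.valuation x) _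
      (fun _ _ => W.valuation.map_add_lt) (by rwa [map_zero]) fun y hy => ?_
    have hy' := (hnodup.mem_erase_iff).mp hy
    exact hconj y ((isConjRoot_iff_mem_minpoly_aroots hint).mpr hy'.2) hy'.1
  have hax : W.valuation (algebraMap K L a) = W.valuation x := by
    rw [W.valuation.map_sub_swap] at ha
    exact W.valuation.map_eq_of_sub_lt ha
  have ha0 : algebraMap K L a ≠ 0 := by
    rw [← W.valuation.ne_zero_iff, hax]
    exact hpos.ne'
  have hsepa : IsSeparable K (x * (algebraMap K L a)⁻¹) := by
    rw [← map_inv₀]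
    exact Field.isSeparable_mul hsep (isSeparable_algebraMap _)
  obtain ⟨c, hc⟩ := mem_range_of_valuation_sub_one_lt hW hsepa (by
      have e : x * (algebraMap K L a)⁻¹ - 1 = (x - algebraMap K L a) * (algebraMap K L a)⁻¹ := by
        rw [sub_mul, mul_inv_cancel₀ ha0]
      rw [e, map_mul, map_inv₀, hax]
      exact (mul_inv_lt_iff₀ hpos).mpr (by rwa [one_mul])) fun y hy hyx => by
    obtain ⟨σ, rfl⟩ := hy.symm.exists_algEquiv
    rw [map_mul, map_inv₀, AlgEquiv.commutes] at hyx ⊢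
    rw [map_mul, map_inv₀, hax]
    refine (mul_inv_lt_iff₀ hpos).mpr ?_
    rw [one_mul]
    exact hconj _ (isConjRoot_of_algEquiv x σ) fun h => hyx (by rw [h])
  refine ⟨c * a, ?_⟩
  rw [map_mul, hc, inv_mul_cancel_right₀ ha0]

theorem valuation_prod_lt_prod {Γ : Type*} [LinearOrderedCommGroupWithZero Γ]
    (w : Valuation L Γ) {Y : Finset L} {m : Γ} (hm : 0 < m) (hY : ∀ y ∈ Y, w y ≤ m)
    {S : Finset L} (hS : S ⊆ Y) (hcard : S.card = (Y.filter fun y => w y = m).card)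
    (hne : S ≠ Y.filter fun y => w y = m) :
    w (∏ y ∈ S, y) < w (∏ y ∈ Y.filter fun y => w y = m, y) := by
  have hT : w (∏ y ∈ Y.filter fun y => w y = m, y) = m ^ S.card := by
    rw [map_prod, Finset.prod_eq_pow_card fun y hy => (Finset.mem_filter.mp hy).2, hcard]
  obtain ⟨s, hs, hsT⟩ : ∃ s ∈ S, s ∉ Y.filter fun y => w y = m := by
    by_contra! h
    exact hne (Finset.eq_of_subset_of_card_le h hcard.ge)
  have hslt : w s < m := lt_of_le_of_ne (hY s (hS hs)) fun h =>
    hsT (Finset.mem_filter.mpr ⟨hS hs, h⟩)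
  rw [hT, map_prod, ← Finset.mul_prod_erase S _ hs, ← Finset.card_erase_add_one hs, pow_succ']
  refine (mul_le_mul' le_rfl ?_).trans_lt (mul_lt_mul_of_pos_right hslt (pow_pos hm _))
  exact Finset.prod_le_pow_card _ _ _ fun y hy => hY y (hS (Finset.mem_of_mem_erase hy))

/-- Conjugate separable elements over a henselian field have the same value. -/
theorem valuation_eq_of_isConjRoot_of_isSeparable [IsAlgClosed L] [Algebra.IsAlgebraic K L]
    [HenselianLocalRing A] (hW : W.comap (algebraMap K L) = A) {x y : L} (hsep : IsSeparable K x)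
    (hxy : IsConjRoot K x y) : W.valuation x = W.valuation y := by
  have hint : IsIntegral K x := hsep.isIntegral
  have : Normal K L := normal_of_isAlgClosed
  set Y := ((minpoly K x).aroots L).toFinset with hYdef
  have hY : ∀ z, z ∈ Y ↔ IsConjRoot K x z := fun z => by
    rw [hYdef, Multiset.mem_toFinset, isConjRoot_iff_mem_minpoly_aroots hint]
  obtain ⟨y₀, hy₀, hmax⟩ := Y.exists_max_image W.valuation ⟨x, (hY x).mpr IsConjRoot.refl⟩
  suffices h : ∀ z, IsConjRoot K x z → W.valuation z = W.valuation y₀ by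
    rw [h x IsConjRoot.refl, h y hxy]
  intro z hz
  by_cases h0 : W.valuation y₀ = 0
  · exact le_antisymm (hmax z ((hY z).mpr hz)) (h0 ▸ zero_le)
  have hpos : 0 < W.valuation y₀ := zero_lt_iff.mpr h0
  set T := Y.filter fun y => W.valuation y = W.valuation y₀ with hT
  have himage : ∀ σ : L ≃ₐ[K] L, T.image σ ≠ T →
      W.valuation (σ (∏ y ∈ T, y)) < W.valuation (∏ y ∈ T, y) := by
    intro σ hσ
    have e : σ (∏ y ∈ T, y) = ∏ y ∈ T.image σ, y := by
      rw [map_prod, Finset.prod_image σ.injective.injOn]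
    rw [e]
    refine valuation_prod_lt_prod W.valuation hpos hmax ?_
      (Finset.card_image_of_injective _ σ.injective) hσ
    intro s hs
    obtain ⟨t, ht, rfl⟩ := Finset.mem_image.mp hs
    exact (hY _).mpr (((hY t).mp (Finset.mem_filter.mp ht).1).trans
      (isConjRoot_of_algEquiv t σ))
  have hprod : ∏ y ∈ T, y ∈ separableClosure K L := prod_mem fun t ht => by
    rw [mem_separableClosure_iff, IsSeparable,
      ← isConjRoot_def.mp ((hY t).mp (Finset.mem_filter.mp ht).1)]
    exact hsep
  obtain ⟨c, hc⟩ := mem_range_of_forall_isConjRoot_valuation_lt hW hprod fun u hu hne => by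
    obtain ⟨σ, rfl⟩ := hu.symm.exists_algEquiv
    refine himage σ fun h => hne ?_
    rw [map_prod]
    conv_rhs => rw [← h, Finset.prod_image σ.injective.injOn]
  obtain ⟨σ, hσ⟩ := (((hY y₀).mp hy₀).symm.trans hz).symm.exists_algEquiv
  have hfix : T.image σ = T := by
    by_contra h
    have := himage σ h
    rw [← hc, AlgEquiv.commutes] at this
    exact lt_irrefl _ this
  have hzT : z ∈ T := by
    rw [← hfix, ← hσ]
    exact Finset.mem_image_of_mem _ (Finset.mem_filter.mpr ⟨hy₀, rfl⟩)
  exact (Finset.mem_filter.mp hzT).2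

/-- Conjugate elements over a henselian field have the same value. -/
theorem valuation_eq_of_isConjRoot [IsAlgClosed L] [Algebra.IsAlgebraic K L]
    [HenselianLocalRing A] (hW : W.comap (algebraMap K L) = A) {x y : L}
    (hxy : IsConjRoot K x y) : W.valuation x = W.valuation y := by
  have : Normal K L := normal_of_isAlgClosed
  obtain ⟨σ, rfl⟩ := hxy.symm.exists_algEquiv
  obtain ⟨n, z, hz⟩ := IsPurelyInseparable.pow_mem (separableClosure K L) (ringExpChar K) x
  have hsep : IsSeparable K (x ^ ringExpChar K ^ n) := hz ▸ z.2
  have h := valuation_eq_of_isConjRoot_of_isSeparable hW hsep (isConjRoot_of_algEquiv _ σ)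
  rw [map_pow, map_pow, map_pow] at h
  exact (pow_left_inj₀ zero_le zero_le (pow_ne_zero n (expChar_pos K _).ne')).mp h

theorem isAlgMaximal_of_henselianLocalRing_of_kExtremal {K : Type u} [Field K]
    {A : ValuationSubring K} [HenselianLocalRing A] (hext : ∀ f : K[X], KExtremal A f) :
    IsAlgMaximal A := by
  intro L _ _ _ B hB himm x
  by_contra hx
  obtain ⟨W, hW⟩ := exists_valuationSubring_comap_eq
    (IsAlgClosed.lift : L →ₐ[K] AlgebraicClosure K).toRingHom B
  set i : L →ₐ[K] AlgebraicClosure K := IsAlgClosed.lift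
  have hWA : W.comap (algebraMap K (AlgebraicClosure K)) = A := by
    rw [← hB, ← hW, ValuationSubring.comap_comap]
    congr 1
    exact i.comp_algebraMap.symm
  have hint : IsIntegral K (i x) := Algebra.IsIntegral.isIntegral _
  have hs := IsAlgClosed.splits ((minpoly K (i x)).map (algebraMap K (AlgebraicClosure K)))
  have heval : ∀ c : K, W.valuation (algebraMap K _ ((minpoly K (i x)).eval c)) =
      W.valuation (i x - algebraMap K _ c) ^
        ((minpoly K (i x)).aroots (AlgebraicClosure K)).card := by
    intro c
    rw [← eval_map_apply, hs.eval_eq_prod_roots_of_monic ((minpoly.monic hint).map _),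
      map_multiset_prod, Multiset.map_map]
    refine (congrArg Multiset.prod (Multiset.eq_replicate_of_mem fun r hr => ?_)).trans
      (by rw [Multiset.prod_replicate, Multiset.card_map])
    obtain ⟨y, hy, rfl⟩ := Multiset.mem_map.mp hr
    have hconj := (isConjRoot_iff_mem_minpoly_aroots hint).mpr hy
    rw [Function.comp_apply, W.valuation.map_sub_swap]
    exact (valuation_eq_of_isConjRoot hWA (hconj.sub_algebraMap c)).symm
  have hcard : ((minpoly K (i x)).aroots (AlgebraicClosure K)).card ≠ 0 :=
    (Multiset.card_pos_iff_exists_mem.mpr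
      ⟨i x, (isConjRoot_iff_mem_minpoly_aroots hint).mp IsConjRoot.refl⟩).ne'
  obtain ⟨a, ha⟩ := hext (minpoly K (i x))
  have hxa : x - algebraMap K L a ≠ 0 := fun h => hx ⟨a, (sub_eq_zero.mp h).symm⟩
  obtain ⟨d, hd⟩ := himm.1 _ hxa
  have hd0 : algebraMap K L d ≠ 0 := by
    rw [← B.valuation.ne_zero_iff, ← hd, B.valuation.ne_zero_iff]
    exact hxa
  have hd1 : B.valuation ((x - algebraMap K L a) / algebraMap K L d) = 1 := by
    rw [map_div₀, hd, div_self ((B.valuation.ne_zero_iff).mpr hd0)]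
  obtain ⟨e, he⟩ := himm.2 _ hd1.le
  have hlt : B.valuation (x - algebraMap K L (a + e * d)) <
      B.valuation (x - algebraMap K L a) := by
    have h₁ : x - algebraMap K L (a + e * d) =
        ((x - algebraMap K L a) / algebraMap K L d - algebraMap K L e) * algebraMap K L d := by
      rw [map_add, map_mul, sub_mul, div_mul_cancel₀ _ hd0]
      ring
    rw [h₁, map_mul, hd]
    exact mul_lt_of_lt_one_left (zero_lt_iff.mpr ((B.valuation.ne_zero_iff).mpr hd0)) he
  subst hW
  rw [valuation_comap_lt_iff] at hlt
  have h₂ := ha (a + e * d)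
  rw [← hWA, valuation_comap_le_iff, heval, heval] at h₂
  have h₃ := (pow_le_pow_iff_left₀ zero_le zero_le hcard).mp h₂
  refine absurd hlt (not_lt.mpr ?_)
  simpa using h₃

end Henselian

/-- A valued field is algebraically maximal if and only if it is henselian and `K`-extremal with
respect to every polynomial in one variable with coefficients in `K`. -/
theorem statement6 {K : Type u} [Field K] (A : ValuationSubring K) :
    IsAlgMaximal A ↔ (HenselianLocalRing A ∧ ∀ f : Polynomial K, KExtremal A f) := by
  refine ⟨fun h => ⟨h.henselianLocalRing, h.kExtremal⟩, fun ⟨h, hext⟩ => ?_⟩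
  exact isAlgMaximal_of_henselianLocalRing_of_kExtremal hext

end ValuedDefect
end
end

section
/- If a valued field (K,v) is K-extremal with respect to every separable polynomial in one variable with coefficients in K, then (K,v) is henselian; the same holds with O-extremal in place of K-extremal. -/
open scoped Classical

noncomputable section

namespace ValuedDefect

universe u v

variable {K : Type u} {L : Type v} [Field K] [Field L]

open Polynomial IsLocalRing

section Hensel

variable {R : Type*} [CommRing R] [IsLocalRing R]

/-- If `f` has nonzero non-unit value and unit derivative at `r`, then some value of `f` does not
divide `f(r)`: a Newton step strictly improves `r`. -/
theorem exists_not_eval_dvd_eval [IsDomain R] {f : R[X]} {r : R}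
    (hr : f.eval r ∈ maximalIdeal R) (hr0 : f.eval r ≠ 0) (hr' : IsUnit (f.derivative.eval r)) :
    ∃ y, ¬ f.eval y ∣ f.eval r := by
  obtain ⟨u, hu⟩ := hr'
  obtain ⟨c, hc⟩ := exists_mul_sq_add_linear_part_eq_eval_add f r (-(f.eval r * ↑u⁻¹))
  refine ⟨r + -(f.eval r * ↑u⁻¹), fun ⟨d, hd⟩ => ?_⟩
  have hu1 : (u : R) * ↑u⁻¹ = 1 := u.mul_inv
  rw [← hu] at hc
  have hsq : f.eval (r + -(f.eval r * ↑u⁻¹)) = f.eval r * (f.eval r * (c * ↑u⁻¹ ^ 2)) := by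
    linear_combination hc.symm - f.eval r * hu1
  rw [hsq, mul_assoc] at hd
  have h1 : 1 = f.eval r * (c * ↑u⁻¹ ^ 2) * d := mul_left_cancel₀ hr0 (by rwa [mul_one])
  refine (mem_maximalIdeal _).mp hr (IsUnit.of_mul_eq_one (c * ↑u⁻¹ ^ 2 * d) ?_)
  rw [h1]
  ring

theorem isUnit_eval_derivative_of_sub_mem {f : R[X]} {a b : R} (hab : b - a ∈ maximalIdeal R)
    (ha : IsUnit (f.derivative.eval a)) : IsUnit (f.derivative.eval b) := by
  by_contra hb
  refine (mem_maximalIdeal _).mp ?_ ha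
  have hd := Ideal.mem_of_dvd _ (sub_dvd_eval_sub b a f.derivative) hab
  have := sub_mem ((mem_maximalIdeal _).mpr hb) hd
  rwa [sub_sub_cancel] at this

theorem eval_mem_of_sub_mem {f : R[X]} {a b : R} (hab : b - a ∈ maximalIdeal R)
    (ha : f.eval a ∈ maximalIdeal R) : f.eval b ∈ maximalIdeal R := by
  have := add_mem (Ideal.mem_of_dvd _ (sub_dvd_eval_sub b a f) hab) ha
  rwa [sub_add_cancel] at this

/-- If a product has a simple root in the residue field at which the second factor does not
vanish, then the first factor has a simple root there. -/
theorem simple_root_of_mul {p q : R[X]} {a : R} (h : (p * q).eval a ∈ maximalIdeal R)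
    (h' : IsUnit ((p * q).derivative.eval a)) (hq : q.eval a ∉ maximalIdeal R) :
    p.eval a ∈ maximalIdeal R ∧ IsUnit (p.derivative.eval a) := by
  rw [eval_mul] at h
  have hp := ((maximalIdeal.isMaximal R).isPrime.mem_or_mem h).resolve_right hq
  refine ⟨hp, ?_⟩
  by_contra hp'
  refine (mem_maximalIdeal _).mp ?_ h'
  rw [derivative_mul, eval_add, eval_mul, eval_mul]
  exact add_mem (Ideal.mul_mem_right _ _ ((mem_maximalIdeal _).mpr hp'))
    (Ideal.mul_mem_right _ _ hp)

/-- One of the factors of a product with a simple root in the residue field does not vanish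
there. -/
theorem eval_notMem_or_of_mul {p q : R[X]} {a : R}
    (h' : IsUnit ((p * q).derivative.eval a)) :
    p.eval a ∉ maximalIdeal R ∨ q.eval a ∉ maximalIdeal R := by
  by_contra! ⟨hp, hq⟩
  refine (mem_maximalIdeal _).mp ?_ h'
  rw [derivative_mul, eval_add, eval_mul, eval_mul]
  exact add_mem (Ideal.mul_mem_left _ _ hq) (Ideal.mul_mem_right _ _ hp)

/-- An integrally closed local domain is henselian as soon as every monic polynomial that is
separable over the fraction field and has a root in the residue field takes a value divisible by
all its other values. -/
theorem henselianLocalRing_of_exists_forall_eval_dvd [IsDomain R] [IsIntegrallyClosed R]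
    (K : Type*) [Field K] [Algebra R K] [IsFractionRing R K]
    (H : ∀ f : R[X], f.Monic → (f.map (algebraMap R K)).Separable →
      (∃ a, f.eval a ∈ maximalIdeal R) → ∃ b, ∀ c, f.eval c ∣ f.eval b) :
    HenselianLocalRing R where
  is_henselian := by
    intro f
    induction hn : f.natDegree using Nat.strong_induction_on generalizing f with
    | _ n ih =>
    subst hn
    intro hf a ha ha'
    by_contra! hroot
    have hinj : Function.Injective (algebraMap R K) := IsFractionRing.injective R K
    have hfactor : ∀ p q : R[X], p.Monic → q.Monic → p * q = f →
        q.eval a ∉ maximalIdeal R → q = 1 := by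
      rintro p q hp hq rfl hqa
      obtain ⟨hpa, hpa'⟩ := simple_root_of_mul ha ha' hqa
      by_contra hq1
      have hlt : p.natDegree < (p * q).natDegree := by
        rw [hp.natDegree_mul hq]
        have : q.natDegree ≠ 0 := fun h => hq1 (hq.natDegree_eq_zero.mp h)
        lia
      obtain ⟨r, hr, hra⟩ := ih _ hlt p rfl hp a hpa hpa'
      exact hroot r (by simp [IsRoot.def, hr.eq_zero]) hra
    have hf1 : f ≠ 1 := by
      rintro rfl
      simp at ha'
    have hirr : Irreducible f := by
      refine hf.irreducible_iff_natDegree.mpr ⟨hf1, fun p q hp hq hpq => ?_⟩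
      rcases eval_notMem_or_of_mul (p := p) (q := q) (a := a) (by rwa [hpq]) with h | h
      · left
        rw [hfactor q p hq hp (by rwa [mul_comm]) h, natDegree_one]
      · right
        rw [hfactor p q hp hq hpq h, natDegree_one]
    have hsep : (f.map (algebraMap R K)).Separable := by
      rw [separable_iff_derivative_ne_zero
        (hf.irreducible_iff_irreducible_map_fraction_map.mp hirr), derivative_map,
        Ne, Polynomial.map_eq_zero_iff hinj]
      intro h
      simp [h] at ha'
    obtain ⟨b, hb⟩ := H f hf hsep ⟨a, ha⟩
    have hno : ∀ r, f.eval r = f.eval b → r - a ∉ maximalIdeal R := by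
      intro r hrb hra
      obtain ⟨y, hy⟩ := exists_not_eval_dvd_eval (eval_mem_of_sub_mem hra ha)
        (fun h => hroot r h hra) (isUnit_eval_derivative_of_sub_mem hra ha')
      exact hy (hrb ▸ hb y)
    have hba := hno b rfl
    have hfb : f.eval b ∈ maximalIdeal R := Ideal.mem_of_dvd _ (hb a) ha
    have hdeg : 0 < f.degree := hf.degree_pos_of_not_isUnit hirr.not_isUnit
    have hgm : (f - C (f.eval b)).Monic :=
      hf.sub_of_left (lt_of_le_of_lt degree_C_le hdeg)
    obtain ⟨q, hq⟩ := X_sub_C_dvd_sub_C_eval (p := f) (a := b)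
    have hqm : q.Monic := (monic_X_sub_C b).of_mul_monic_left (hq ▸ hgm)
    rw [mul_comm] at hq
    have hlt : q.natDegree < f.natDegree := by
      have h := congrArg natDegree hq
      rw [natDegree_sub_C, hqm.natDegree_mul (monic_X_sub_C b), natDegree_X_sub_C] at h
      lia
    obtain ⟨hqa, hqa'⟩ := simple_root_of_mul (p := q) (q := X - C b) (a := a)
      (by rw [← hq, eval_sub, eval_C]; exact sub_mem ha hfb)
      (by rw [← hq]; simpa using ha')
      (by rw [eval_sub, eval_X, eval_C, ← neg_mem_iff, neg_sub]; exact hba)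
    obtain ⟨r, hr, hra⟩ := ih _ hlt q rfl hqm a hqa hqa'
    refine hno r ?_ hra
    have h := congrArg (eval r) hq
    rwa [eval_sub, eval_C, eval_mul, hr.eq_zero, zero_mul, sub_eq_zero] at h

theorem dvd_iff_valuation_le (A : ValuationSubring K) (x y : A) :
    x ∣ y ↔ A.valuation (y : K) ≤ A.valuation (x : K) := by
  rw [A.valuation_le_iff]
  constructor
  · rintro ⟨d, rfl⟩
    exact ⟨d, by push_cast; ring⟩
  · rintro ⟨d, hd⟩
    exact ⟨d, Subtype.ext (by push_cast; rw [← hd, mul_comm])⟩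

theorem eval_map_algebraMap_coe (A : ValuationSubring K) (f : A[X]) (x : A) :
    (f.map (algebraMap A K)).eval (x : K) = f.eval x :=
  (eval_map _ _).trans (eval₂_at_apply (algebraMap A K) x)

theorem OExtremal.exists_forall_eval_dvd {A : ValuationSubring K} {f : A[X]}
    (h : OExtremal A (f.map (algebraMap A K))) : ∃ b, ∀ c, f.eval c ∣ f.eval b := by
  obtain ⟨b, hb⟩ := h
  refine ⟨b, fun c => (dvd_iff_valuation_le A _ _).mpr ?_⟩
  simpa only [eval_map_algebraMap_coe] using hb c

/-- For monic integral polynomials, `K`-extremality implies `O`-extremality. -/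
theorem KExtremal.oExtremal {A : ValuationSubring K} {f : A[X]} (hf : f.Monic)
    (h : KExtremal A (f.map (algebraMap A K))) : OExtremal A (f.map (algebraMap A K)) := by
  obtain ⟨b, hb⟩ := h
  have hfb : (f.map (algebraMap A K)).eval b ∈ A := by
    rw [← A.valuation_le_one_iff]
    refine (hb ((0 : A) : K)).trans ?_
    rw [eval_map_algebraMap_coe]
    exact A.valuation_le_one _
  obtain hf0 | hf0 := eq_or_ne f 1
  · exact ⟨0, fun c => by simp [hf0]⟩
  have hint : IsIntegral A b := by
    refine ⟨f - C ⟨_, hfb⟩, hf.sub_of_left (lt_of_le_of_lt degree_C_le ?_), ?_⟩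
    · exact natDegree_pos_iff_degree_pos.mp
        (Nat.pos_of_ne_zero fun h => hf0 (hf.natDegree_eq_zero.mp h))
    · rw [eval₂_sub, eval₂_C, ← eval_map]
      exact sub_self _
  obtain ⟨b, rfl⟩ := IsIntegrallyClosed.algebraMap_eq_of_integral hint
  exact ⟨b, fun c => hb c⟩

end Hensel

/-- If a valued field is `K`-extremal with respect to every separable polynomial in one
variable, then it is henselian; the same holds with `O`-extremal in place of `K`-extremal. -/
theorem statement7 {K : Type u} [Field K] (A : ValuationSubring K) :
    ((∀ f : Polynomial K, f.Separable → KExtremal A f) → HenselianLocalRing A) ∧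
    ((∀ f : Polynomial K, f.Separable → OExtremal A f) → HenselianLocalRing A) := by
  refine ⟨fun h => ?_, fun h => ?_⟩ <;>
    refine henselianLocalRing_of_exists_forall_eval_dvd K fun f hf hsep _ => ?_
  · exact (KExtremal.oExtremal hf (h _ hsep)).exists_forall_eval_dvd
  · exact (h _ hsep).exists_forall_eval_dvd

end ValuedDefect
end
end
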